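/- arXiv:2201.06939 — 3 statements merged into one kernel-verified Lean document; each statement's English description precedes it below -/
import Mathlib

section
/- Let a, b, k be positive integers with gcd(a,b) = 1 and k ≥ 2. If the multiplicative order of b modulo a is relatively prime to k, then there exist infinitely many natural numbers n with n ≡ b (mod a) such that σ(n) is a perfect k-th power. -/
open Finset in
lemma aux_cover {G ι : Type} [AddCommGroup G] [DecidableEq ι] (k : ℕ) (hk : 1 ≤ k)
    (hG : ∀ g : G, k • g = 0) (v : ι → G) (s : Finset ι) :
    ∀ Ω : Finset (AddChar G ℂ), #Ω * (k - 1) ^ #s < k ^ #s →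
      ∃ c : ι → ℂ, (∀ i, c i ≠ 0) ∧ ∀ ψ ∈ Ω, ∃ i ∈ s, ψ (v i) = c i := by
  classical
  induction s using Finset.induction_on with
  | empty =>
    intro Ω h
    have : Ω = ∅ := by simpa using h
    exact ⟨fun _ => 1, by simp, by simp [this]⟩
  | insert i s hi ih =>
    intro Ω h
    rw [card_insert_of_notMem hi] at h
    have hmaps : ∀ ψ ∈ Ω, ψ (v i) ∈ Polynomial.nthRootsFinset k (1 : ℂ) := by
      intro ψ _
      rw [Polynomial.mem_nthRootsFinset (by omega)]
      rw [← AddChar.map_nsmul_eq_pow, hG, AddChar.map_zero_eq_one]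
    have hcardR : #(Polynomial.nthRootsFinset k (1 : ℂ)) ≤ k := by
      rw [Polynomial.nthRootsFinset_def]
      exact (Multiset.toFinset_card_le _).trans (Polynomial.card_nthRoots k 1)
    have hpig : ∃ z ∈ Polynomial.nthRootsFinset k (1 : ℂ),
        #Ω ≤ k * #(Ω.filter fun ψ => ψ (v i) = z) := by
      by_contra hcon
      push Not at hcon
      have h1 := card_eq_sum_card_fiberwise hmaps
      have hne : (Polynomial.nthRootsFinset k (1 : ℂ)).Nonempty :=
        ⟨1, by rw [Polynomial.mem_nthRootsFinset (by omega)]; simp⟩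
      have h2 := Finset.sum_lt_sum_of_nonempty hne hcon
      rw [← Finset.mul_sum, ← h1, sum_const, smul_eq_mul] at h2
      have := Nat.mul_le_mul_right (#Ω) hcardR
      omega
    obtain ⟨z, hz, hle⟩ := hpig
    have hsplit := card_filter_add_card_filter_not (s := Ω) (fun ψ => ψ (v i) = z)
    obtain ⟨c, hc0, hc⟩ := ih (Ω.filter fun ψ => ¬ ψ (v i) = z) (by
      have hb : k * #(Ω.filter fun ψ => ¬ ψ (v i) = z) ≤ (k - 1) * #Ω := by
        obtain ⟨m, rfl⟩ : ∃ m, k = m + 1 := ⟨k - 1, by omega⟩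
        simp only [Nat.add_sub_cancel]
        nlinarith
      have : k * (#(Ω.filter fun ψ => ¬ ψ (v i) = z) * (k - 1) ^ #s) < k * k ^ #s := by
        calc _ = k * #(Ω.filter fun ψ => ¬ ψ (v i) = z) * (k - 1) ^ #s := by ring
          _ ≤ (k - 1) * #Ω * (k - 1) ^ #s := Nat.mul_le_mul_right _ hb
          _ = #Ω * (k - 1) ^ (#s + 1) := by ring
          _ < k ^ (#s + 1) := h
          _ = _ := by ring
      exact lt_of_mul_lt_mul_left this (by omega))
    refine ⟨Function.update c i z, ?_, ?_⟩
    · intro j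
      by_cases hj : j = i
      · subst hj
        rw [Function.update_self]
        rw [Polynomial.mem_nthRootsFinset (by omega)] at hz
        rintro rfl
        rw [zero_pow (by omega)] at hz
        exact zero_ne_one hz
      · rw [Function.update_of_ne hj]; exact hc0 j
    · intro ψ hψ
      by_cases hv : ψ (v i) = z
      · exact ⟨i, by simp, by simpa using hv⟩
      · obtain ⟨j, hj, hj'⟩ := hc ψ (by simp [hψ, hv])
        refine ⟨j, by simp [hj], ?_⟩
        rw [Function.update_of_ne (by rintro rfl; exact hi hj)]
        exact hj'

open Finset in
lemma aux_zero_sum {G ι : Type} [AddCommGroup G] [Fintype G] [DecidableEq ι] (k : ℕ) (hk : 1 ≤ k)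
    (hG : ∀ g : G, k • g = 0) (v : ι → G) (s : Finset ι)
    (h : Fintype.card G * (k - 1) ^ #s < k ^ #s) :
    ∃ t ⊆ s, t.Nonempty ∧ ∑ i ∈ t, v i = 0 := by
  classical
  obtain ⟨c, hc0, hc⟩ := aux_cover k hk hG v s Finset.univ (by
    rw [Finset.card_univ, AddChar.card_eq]; exact h)
  by_contra hcon
  push Not at hcon
  have h0 : ∑ ψ : AddChar G ℂ, ∏ i ∈ s, (ψ (v i) + -c i) = 0 := by
    refine Finset.sum_eq_zero fun ψ _ => ?_
    obtain ⟨i, hi, hi'⟩ := hc ψ (Finset.mem_univ _)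
    exact Finset.prod_eq_zero hi (by rw [hi']; ring)
  simp_rw [Finset.prod_add] at h0
  rw [Finset.sum_comm] at h0
  have h1 : ∀ t ∈ s.powerset, ∑ ψ : AddChar G ℂ, (∏ i ∈ t, ψ (v i)) * ∏ i ∈ s \ t, -c i
      = if t = ∅ then (Fintype.card G : ℂ) * ∏ i ∈ s, -c i else 0 := by
    intro t ht
    rw [← Finset.sum_mul]
    have : ∀ ψ : AddChar G ℂ, ∏ i ∈ t, ψ (v i) = ψ (∑ i ∈ t, v i) := by
      intro ψ; exact (map_prod ψ.toMonoidHom (fun i => Multiplicative.ofAdd (v i)) t).symm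
    simp_rw [this, AddChar.sum_apply_eq_ite]
    by_cases hte : t = ∅
    · subst hte; simp
    · rw [if_neg hte, if_neg (hcon t (mem_powerset.1 ht) (nonempty_iff_ne_empty.2 hte)), zero_mul]
  rw [Finset.sum_congr rfl h1] at h0
  rw [Finset.sum_ite_eq' s.powerset ∅, if_pos (by simp)] at h0
  rcases mul_eq_zero.1 h0 with h2 | h2
  · exact Fintype.card_ne_zero (α := G) (by exact_mod_cast h2)
  · obtain ⟨i, _, hi⟩ := Finset.prod_eq_zero_iff.1 h2
    exact hc0 i (neg_eq_zero.1 hi)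

open Finset in
lemma aux_walk {H : Type} [AddCommGroup H] [DecidableEq H] (A : Finset H) (h : H) (j : ℕ)
    (hA : ∀ a ∈ A, a + j • h ∉ A) : #A ≤ j * #(A.filter fun a => a + h ∉ A) := by
  have hsub : A ⊆ (range j).biUnion fun i => (A.filter fun a => a + h ∉ A).image (fun a => a - i • h) := by
    intro a ha
    have hex : ∃ n, a + n • h ∉ A := ⟨j, hA a ha⟩
    classical
    have hn := Nat.find_spec hex
    have hmin : Nat.find hex ≤ j := Nat.find_min' hex (hA a ha)
    have hpos : Nat.find hex ≠ 0 := by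
      intro h0; rw [h0] at hn; simp [ha] at hn
    obtain ⟨m, hm⟩ := Nat.exists_eq_succ_of_ne_zero hpos
    have hm' : a + m • h ∈ A := by
      by_contra hc
      exact Nat.find_min hex (by omega : m < Nat.find hex) hc
    rw [mem_biUnion]
    refine ⟨m, mem_range.2 (by omega), mem_image.2 ⟨a + m • h, mem_filter.2 ⟨hm', ?_⟩, by abel⟩⟩
    rw [hm, Nat.succ_eq_add_one, succ_nsmul] at hn
    rwa [add_assoc]
  calc #A ≤ _ := card_le_card hsub
    _ ≤ ∑ i ∈ range j, #((A.filter fun a => a + h ∉ A).image (fun a => a - i • h)) := card_biUnion_le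
    _ ≤ ∑ i ∈ range j, #(A.filter fun a => a + h ∉ A) := sum_le_sum fun i _ => card_image_le
    _ = _ := by simp

open Finset in
lemma aux_growth {H ι : Type} [AddCommGroup H] [DecidableEq H] [DecidableEq ι] (w : ι → H) (e : H)
    (j : ℕ) (hj : ∀ i, j • w i = e) (s : Finset ι) :
    (∀ t ⊆ s, ∀ t' ⊆ s, ∑ i ∈ t', w i ≠ ∑ i ∈ t, w i + e) →
    (j + 1) ^ #s ≤ #(s.powerset.image fun t => ∑ i ∈ t, w i) * j ^ #s := by
  induction s using Finset.induction_on with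
  | empty => intro _; simp
  | insert i s hi ih =>
    intro hno
    have ih' := ih fun t ht t' ht' => hno t (ht.trans (subset_insert _ _)) t' (ht'.trans (subset_insert _ _))
    set A := s.powerset.image fun t => ∑ i ∈ t, w i with hA
    have hmem : ∀ a, a ∈ A ↔ ∃ t ⊆ s, ∑ i ∈ t, w i = a := by
      intro a; simp [hA]
    have hw := aux_walk A (w i) j (by
      intro a ha ha'
      obtain ⟨t, ht, rfl⟩ := (hmem _).1 ha
      obtain ⟨t', ht', h'⟩ := (hmem _).1 ha'
      rw [hj] at h'
      exact hno t (ht.trans (subset_insert _ _)) t' (ht'.trans (subset_insert _ _)) h')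
    have hsub : A ∪ (A.filter fun a => a + w i ∉ A).image (fun a => a + w i) ⊆
        (insert i s).powerset.image fun t => ∑ i ∈ t, w i := by
      intro a ha
      rw [mem_union] at ha
      rcases ha with ha | ha
      · obtain ⟨t, ht, rfl⟩ := (hmem _).1 ha
        exact mem_image.2 ⟨t, mem_powerset.2 (ht.trans (subset_insert _ _)), rfl⟩
      · obtain ⟨b, hb, rfl⟩ := mem_image.1 ha
        obtain ⟨t, ht, rfl⟩ := (hmem _).1 (mem_filter.1 hb).1
        refine mem_image.2 ⟨insert i t, mem_powerset.2 (insert_subset_insert _ ht), ?_⟩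
        rw [sum_insert (fun h => hi (ht h)), add_comm]
    have hdis : Disjoint A ((A.filter fun a => a + w i ∉ A).image (fun a => a + w i)) := by
      rw [disjoint_left]
      intro a ha ha'
      obtain ⟨b, hb, rfl⟩ := mem_image.1 ha'
      exact (mem_filter.1 hb).2 ha
    have hc := card_le_card hsub
    rw [card_union_of_disjoint hdis, card_image_of_injective _ (add_left_injective _)] at hc
    rw [card_insert_of_notMem hi]
    set B := #((insert i s).powerset.image fun t => ∑ i ∈ t, w i)
    calc (j + 1) ^ (#s + 1) = (j + 1) ^ #s * (j + 1) := by ring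
      _ ≤ (#A * j ^ #s) * (j + 1) := Nat.mul_le_mul_right _ ih'
      _ = (#A * j + #A) * j ^ #s := by ring
      _ ≤ (B * j) * j ^ #s := by
          apply Nat.mul_le_mul_right
          nlinarith
      _ = B * j ^ (#s + 1) := by ring

open Finset in
lemma aux_gadget {G ι : Type} [AddCommGroup G] [Fintype G] [DecidableEq ι] (k o j : ℕ)
    (ho : 0 < o) (hkj : k ∣ j) (hoj : (j : ZMod o) = 1)
    (hG : ∀ g : G, k • g = 0) (v : ι → G) (s : Finset ι)
    (h : Fintype.card G * o * j ^ #s < (j + 1) ^ #s) :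
    ∃ t ⊆ s, ∃ t' ⊆ s, ∑ i ∈ t', v i = ∑ i ∈ t, v i ∧ (#t' : ZMod o) = #t + 1 := by
  classical
  have : NeZero o := ⟨ho.ne'⟩
  by_contra hcon
  push Not at hcon
  have := aux_growth (H := G × ZMod o) (fun i => (v i, 1)) (0, 1) j (by
    intro i
    obtain ⟨m, rfl⟩ := hkj
    ext
    · simp [mul_comm k m, mul_nsmul', hG]
    · simpa using hoj) s (by
    intro t ht t' ht' heq
    have h1 := congrArg Prod.fst heq
    have h2 := congrArg Prod.snd heq
    simp only [Prod.fst_sum, Prod.snd_sum, Prod.fst_add, Prod.snd_add, add_zero] at h1 h2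
    exact hcon t ht t' ht' h1 (by simpa using h2))
  have hcard := card_le_univ (s.powerset.image fun t => ∑ i ∈ t, ((v i, 1) : G × ZMod o))
  rw [Fintype.card_prod, ZMod.card] at hcard
  have := Nat.mul_le_mul_right (j ^ #s) hcard
  omega

open Finset in
lemma aux_multi {G ι : Type} [AddCommGroup G] [Fintype G] [DecidableEq ι] (k o j q : ℕ)
    (ho : 0 < o) (hkj : k ∣ j) (hoj : (j : ZMod o) = 1)
    (hG : ∀ g : G, k • g = 0) (v : ι → G)
    (h : Fintype.card G * o * j ^ q < (j + 1) ^ q) (n : ℕ) :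
    ∀ s : Finset ι, n * q ≤ #s → ∃ g : G, ∃ x : ZMod o, ∀ m ≤ n, ∃ t ⊆ s,
      ∑ i ∈ t, v i = g ∧ (#t : ZMod o) = x + m := by
  induction n with
  | zero =>
    intro s _
    refine ⟨0, 0, fun m hm => ⟨∅, by simp, by simp, ?_⟩⟩
    have : m = 0 := by omega
    subst this; simp
  | succ n ih =>
    intro s hs
    have hq : q ≤ #s := by nlinarith
    obtain ⟨s1, hs1, hc1⟩ := exists_subset_card_eq hq
    obtain ⟨t, ht, t', ht', hsum, hcard⟩ := aux_gadget k o j ho hkj hoj hG v s1 (by rw [hc1]; exact h)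
    obtain ⟨g, x, hgx⟩ := ih (s \ s1) (by
      rw [card_sdiff_of_subset hs1, hc1]
      have : (n + 1) * q = n * q + q := by ring
      omega)
    refine ⟨∑ i ∈ t, v i + g, (#t : ZMod o) + x, ?_⟩
    have key : ∀ t0 ⊆ s1, ∀ m ≤ n, ∃ u ⊆ s, ∑ i ∈ u, v i = ∑ i ∈ t0, v i + g ∧
        (#u : ZMod o) = #t0 + (x + m) := by
      intro t0 ht0 m hm
      obtain ⟨u, hu, hu1, hu2⟩ := hgx m hm
      have hd : Disjoint t0 u := by
        rw [disjoint_left]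
        intro a ha ha'
        exact (mem_sdiff.1 (hu ha')).2 (ht0 ha)
      refine ⟨t0 ∪ u, union_subset (ht0.trans hs1) (hu.trans sdiff_subset), ?_, ?_⟩
      · rw [sum_union hd, hu1]
      · rw [card_union_of_disjoint hd, Nat.cast_add, hu2]
    intro m hm
    by_cases hmn : m ≤ n
    · obtain ⟨u, hu, h1, h2⟩ := key t ht m hmn
      exact ⟨u, hu, h1, by rw [h2]; ring⟩
    · have : m = n + 1 := by omega
      subst this
      obtain ⟨u, hu, h1, h2⟩ := key t' ht' n le_rfl
      exact ⟨u, hu, by rw [h1, hsum], by rw [h2, hcard]; push_cast; ring⟩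

open Finset in
lemma aux_binom {ι : Type} [DecidableEq ι] (s : Finset ι) (E : ℕ) :
    #(s.powerset.filter fun t => #t < E) * 4 ^ #s ≤ 4 ^ E * 5 ^ #s := by
  have h5 : (5 : ℕ) ^ #s = ∑ t ∈ s.powerset, 4 ^ (#s - #t) := by
    have := Finset.prod_add (fun _ : ι => (1 : ℕ)) (fun _ => 4) s
    simp only [prod_const, one_pow, one_mul] at this
    norm_num at this
    rw [this]
    refine sum_congr rfl fun t ht => ?_
    rw [card_sdiff_of_subset (mem_powerset.1 ht)]
  rw [h5, mul_sum, ← smul_eq_mul, ← sum_const]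
  calc _ ≤ ∑ t ∈ s.powerset.filter fun t => #t < E, 4 ^ E * 4 ^ (#s - #t) := by
        refine sum_le_sum fun t ht => ?_
        rw [← pow_add]
        apply Nat.pow_le_pow_right (by norm_num)
        have := (mem_filter.1 ht).2
        omega
    _ ≤ _ := sum_le_sum_of_subset (filter_subset _ _)

open Finset in
lemma aux_shatter {G ι : Type} [AddCommGroup G] [DecidableEq ι] (v : ι → G) (E : ℕ) (hE : 1 ≤ E)
    (hD : ∀ s : Finset ι, #s = E → ∃ t ⊆ s, t.Nonempty ∧ ∑ i ∈ t, v i = 0)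
    (s : Finset ι) (hs : 12 * E ≤ #s) :
    ∃ Q ⊆ s, E ≤ #Q ∧ ∀ t ⊆ Q, ∃ u ⊆ s, ∑ i ∈ u, v i = 0 ∧ Q ∩ u = t := by
  classical
  set Z := s.powerset.filter fun t => ∑ i ∈ t, v i = 0 with hZ
  set B := s.powerset.filter fun t => #t < E with hB
  have h1 : ∀ w ⊆ s, ∃ z ⊆ w, ∑ i ∈ z, v i = 0 ∧ #(w \ z) < E := by
    intro w hw
    obtain ⟨z, hz, hmax⟩ := exists_max_image (w.powerset.filter fun t => ∑ i ∈ t, v i = 0) card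
      ⟨∅, by simp⟩
    rw [mem_filter, mem_powerset] at hz
    refine ⟨z, hz.1, hz.2, ?_⟩
    by_contra hge
    push Not at hge
    obtain ⟨y, hy, hyc⟩ := exists_subset_card_eq hge
    obtain ⟨t, ht, hne, hsum⟩ := hD y hyc
    have hd : Disjoint z t := by
      rw [disjoint_left]
      intro a ha ha'
      exact (mem_sdiff.1 (hy (ht ha'))).2 ha
    have := hmax (z ∪ t) (by
      rw [mem_filter, mem_powerset]
      refine ⟨union_subset hz.1 ((ht.trans hy).trans sdiff_subset), ?_⟩
      rw [sum_union hd, hz.2, hsum, add_zero])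
    rw [card_union_of_disjoint hd] at this
    have := hne.card_pos
    omega
  choose! f hf1 hf2 hf3 using h1
  have h2 : 2 ^ #s ≤ #Z * #B := by
    rw [← card_powerset, ← card_product]
    refine card_le_card_of_injOn (fun w => (f w, w \ f w)) ?_ ?_
    · intro w hw
      have hw := mem_powerset.1 hw
      simp only [coe_product, Set.mem_prod, mem_coe, hZ, hB, mem_filter, mem_powerset]
      exact ⟨⟨(hf1 w hw).trans hw, hf2 w hw⟩, sdiff_subset.trans hw, hf3 w hw⟩
    · intro w hw w' hw' heq
      have hw := mem_powerset.1 hw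
      have hw' := mem_powerset.1 hw'
      simp only [Prod.mk.injEq] at heq
      rw [← union_sdiff_of_subset (hf1 w hw), ← union_sdiff_of_subset (hf1 w' hw'), heq.2, heq.1]
  by_contra hcon
  have h3 : #Z ≤ #B := by
    refine (card_le_card_shatterer Z).trans (card_le_card ?_)
    intro Q hQ
    rw [mem_shatterer] at hQ
    have hQs : Q ⊆ s := by
      obtain ⟨t, ht, hQt⟩ := hQ.exists_superset
      exact hQt.trans (mem_powerset.1 (mem_filter.1 ht).1)
    rw [hB, mem_filter, mem_powerset]
    refine ⟨hQs, ?_⟩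
    by_contra hge
    push Not at hge
    refine hcon ⟨Q, hQs, hge, fun t ht => ?_⟩
    obtain ⟨u, hu, hQu⟩ := hQ ht
    rw [hZ, mem_filter, mem_powerset] at hu
    exact ⟨u, hu.1, hu.2, hQu⟩
  have h4 := aux_binom s E
  rw [← hB] at h4
  have h5 : 2 ^ #s ≤ #B * #B := h2.trans (Nat.mul_le_mul_right _ h3)
  have h6 : 2 ^ #s * (4 ^ #s * 4 ^ #s) ≤ (4 ^ E * 4 ^ E) * (5 ^ #s * 5 ^ #s) := by
    calc _ ≤ #B * #B * (4 ^ #s * 4 ^ #s) := Nat.mul_le_mul_right _ h5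
      _ = (#B * 4 ^ #s) * (#B * 4 ^ #s) := by ring
      _ ≤ (4 ^ E * 5 ^ #s) * (4 ^ E * 5 ^ #s) := Nat.mul_le_mul h4 h4
      _ = _ := by ring
  rw [← mul_pow, ← mul_pow, ← mul_pow, ← mul_pow] at h6
  norm_num at h6
  obtain ⟨d, hd⟩ := Nat.exists_eq_add_of_le hs
  rw [hd, pow_add, pow_add, pow_mul, pow_mul] at h6
  have h7 : (16 : ℕ) ^ E * (25 ^ 12) ^ E < (32 ^ 12) ^ E := by
    rw [← mul_pow]
    exact Nat.pow_lt_pow_left (by norm_num) (by omega)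
  have h8 : (25 : ℕ) ^ d ≤ 32 ^ d := Nat.pow_le_pow_left (by norm_num) d
  have h9 : 0 < (32 : ℕ) ^ d := by positivity
  have : 16 ^ E * ((25 ^ 12) ^ E * 25 ^ d) < (32 ^ 12) ^ E * 32 ^ d := by
    calc _ = (16 ^ E * (25 ^ 12) ^ E) * 25 ^ d := by ring
      _ ≤ (16 ^ E * (25 ^ 12) ^ E) * 32 ^ d := Nat.mul_le_mul_left _ h8
      _ < _ := Nat.mul_lt_mul_of_pos_right h7 h9
  omega

open Finset in
theorem aux_comb (k o : ℕ) (hk : 2 ≤ k) (ho : 0 < o) (hko : Nat.Coprime o k) :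
    ∃ C : ℕ, ∀ (G : Type) [AddCommGroup G] [Fintype G] (r : ℕ), (∀ g : G, k • g = 0) →
      Fintype.card G ≤ k ^ r → ∀ (ι : Type) [DecidableEq ι] (v : ι → G) (s : Finset ι),
      C * (r + 1) ≤ #s → ∃ t ⊆ s, ∑ i ∈ t, v i = 0 ∧ #t ≡ 1 [MOD o] := by
  have : NeZero o := ⟨ho.ne'⟩
  obtain ⟨j, hj1, hj2⟩ := Nat.chineseRemainder hko 1 0
  have hkj0 : k ∣ j := (Nat.modEq_zero_iff_dvd).1 hj2
  -- make it positive
  obtain ⟨J, hJpos, hkJ, hoJ⟩ : ∃ J, 0 < J ∧ k ∣ J ∧ (J : ZMod o) = 1 := by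
    refine ⟨j + o * k, by positivity, (hkj0).add (dvd_mul_left _ _), ?_⟩
    have := (ZMod.natCast_eq_natCast_iff _ _ _).2 hj1
    push_cast at this ⊢
    simp [this]
  have hkJle : k ≤ J := Nat.le_of_dvd hJpos hkJ
  refine ⟨12 * (o * (J * (k + o))), ?_⟩
  intro G _ _ r hG hcard ι _ v s hs
  set q := J * (r * k + o) with hq
  have hqcond : Fintype.card G * o * J ^ q < (J + 1) ^ q := by
    have h2 : 2 * J ^ J ≤ (J + 1) ^ J := by
      have := one_add_mul_le_pow (R := ℚ) (a := 1 / J) (by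
        have : (0 : ℚ) ≤ 1 / J := by positivity
        linarith) J
      have hJ : (J : ℚ) ≠ 0 := by exact_mod_cast hJpos.ne'
      rw [mul_one_div_cancel hJ] at this
      have h3 : ((J : ℚ) + 1) ^ J = J ^ J * (1 + 1 / J) ^ J := by
        rw [← mul_pow]; congr 1; field_simp
      have h4 : (2 : ℚ) * J ^ J ≤ (J + 1) ^ J := by
        rw [h3]
        have : (0 : ℚ) ≤ J ^ J := by positivity
        nlinarith
      exact_mod_cast h4
    have h3 : Fintype.card G * o < 2 ^ (r * k + o) := by
      calc _ ≤ k ^ r * o := Nat.mul_le_mul_right _ hcard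
        _ ≤ (2 ^ k) ^ r * o := Nat.mul_le_mul_right _ (Nat.pow_le_pow_left Nat.lt_two_pow_self.le _)
        _ < (2 ^ k) ^ r * 2 ^ o := Nat.mul_lt_mul_of_pos_left Nat.lt_two_pow_self (by positivity)
        _ = _ := by rw [← pow_mul, ← pow_add, mul_comm k r]
    calc _ < 2 ^ (r * k + o) * J ^ q := Nat.mul_lt_mul_of_pos_right h3 (by positivity)
      _ = (2 * J ^ J) ^ (r * k + o) := by rw [hq, pow_mul, mul_pow]
      _ ≤ ((J + 1) ^ J) ^ (r * k + o) := Nat.pow_le_pow_left h2 _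
      _ = _ := by rw [hq, pow_mul]
  have hqpos : 1 ≤ o * q := by
    have : 0 < o * q := by positivity
    omega
  have hD : ∀ s : Finset ι, #s = o * q → ∃ t ⊆ s, t.Nonempty ∧ ∑ i ∈ t, v i = 0 := by
    intro s hs
    obtain ⟨s1, hs1, hc1⟩ := exists_subset_card_eq (s := s) (n := q) (by rw [hs]; nlinarith)
    obtain ⟨t, ht, h⟩ := aux_zero_sum k (by omega) hG v s1 (by
      rw [hc1]
      have h1 : ((k - 1) * (J + 1)) ^ q ≤ (k * J) ^ q := by
        apply Nat.pow_le_pow_left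
        obtain ⟨m, rfl⟩ : ∃ m, k = m + 1 := ⟨k - 1, by omega⟩
        simp only [Nat.add_sub_cancel]
        nlinarith
      rw [mul_pow, mul_pow] at h1
      have h2 : Fintype.card G * J ^ q < (J + 1) ^ q := by
        refine lt_of_le_of_lt ?_ hqcond
        exact Nat.mul_le_mul_right _ (Nat.le_mul_of_pos_right _ ho)
      have hJq : 0 < J ^ q := by positivity
      have hkq : 0 < k ^ q := by positivity
      have : Fintype.card G * (k - 1) ^ q * (J + 1) ^ q < k ^ q * (J + 1) ^ q := by
        calc _ = Fintype.card G * ((k - 1) ^ q * (J + 1) ^ q) := by ring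
          _ ≤ Fintype.card G * (k ^ q * J ^ q) := Nat.mul_le_mul_left _ h1
          _ = k ^ q * (Fintype.card G * J ^ q) := by ring
          _ < _ := Nat.mul_lt_mul_of_pos_left h2 hkq
      exact lt_of_mul_lt_mul_right this (by positivity))
    exact ⟨t, ht.trans hs1, h⟩
  obtain ⟨Q, hQs, hQc, hQ⟩ := aux_shatter v (o * q) hqpos hD s (by
    refine le_trans ?_ hs
    rw [hq]
    calc 12 * (o * (J * (r * k + o))) ≤ 12 * (o * (J * ((k + o) * (r + 1)))) := by
          gcongr; nlinarith
      _ = _ := by ring)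
  obtain ⟨g, x, hgx⟩ := aux_multi k o J q ho hkJ hoJ hG v hqcond o Q hQc
  obtain ⟨t0, ht0, hg0, -⟩ := hgx 0 (by omega)
  obtain ⟨u, hu, hu0, hQu⟩ := hQ t0 ht0
  set P := u \ Q with hP
  have hPs : ∑ i ∈ P, v i = -g := by
    have h1 : ∑ i ∈ u ∩ Q, v i + ∑ i ∈ P, v i = ∑ i ∈ u, v i := by
      rw [hP]; exact sum_inter_add_sum_sdiff _ _ _
    rw [inter_comm, hQu, hg0, hu0] at h1
    exact eq_neg_of_add_eq_zero_right h1
  obtain ⟨t, ht, hgt, hct⟩ := hgx (1 - x - (#P : ZMod o)).val (ZMod.val_lt _).le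
  have hd : Disjoint t P := by
    rw [disjoint_left]
    intro a ha ha'
    exact (mem_sdiff.1 ha').2 (ht ha)
  refine ⟨t ∪ P, union_subset (ht.trans hQs) (sdiff_subset.trans hu), ?_, ?_⟩
  · rw [sum_union hd, hgt, hPs, add_neg_cancel]
  · rw [← ZMod.natCast_eq_natCast_iff, card_union_of_disjoint hd, Nat.cast_add, hct,
      ZMod.natCast_zmod_val]
    push_cast; ring


open ArithmeticFunction ArithmeticFunction.vonMangoldt in
lemma aux_summable {q : ℕ} [NeZero q] (a : ZMod q) {x : ℝ} (hx : 1 < x) :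
    Summable fun n : ℕ => residueClass a n / (n : ℝ) ^ x :=
  LSeries.summable_real_of_abscissaOfAbsConv_lt <|
        (abscissaOfAbsConv_residueClass_le_one a).trans_lt <| mod_cast hx

open ArithmeticFunction ArithmeticFunction.vonMangoldt in
lemma aux_lower {q : ℕ} [NeZero q] {a : ZMod q} (ha : IsUnit a) :
    ∃ K : ℝ, ∀ x : ℝ, x ∈ Set.Ioc 1 2 → (q.totient : ℝ)⁻¹ / (x - 1) - K ≤
      ∑' n : ℕ, (if n.Prime then residueClass a n else 0) / (n : ℝ) ^ x := by
  obtain ⟨K, hK⟩ := LSeries_residueClass_lower_bound ha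
  have hsum := summable_residueClass_non_primes_div a
  refine ⟨K + ∑' n : ℕ, (if n.Prime then 0 else residueClass a n) / (n : ℝ), fun x hx => ?_⟩
  have h1 := hK hx
  have hs := aux_summable a hx.1
  have hsp : Summable fun n : ℕ => (if n.Prime then residueClass a n else 0) / (n : ℝ) ^ x := by
    refine Summable.of_nonneg_of_le (fun n => ?_) (fun n => ?_) hs
    · have := residueClass_nonneg a n
      split_ifs <;> positivity
    · have := residueClass_nonneg a n
      split_ifs
      · exact le_rfl
      · rw [zero_div]; positivity
  have h2 : ∑' n : ℕ, residueClass a n / (n : ℝ) ^ x ≤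
      ∑' n : ℕ, ((if n.Prime then residueClass a n else 0) / (n : ℝ) ^ x +
        (if n.Prime then 0 else residueClass a n) / (n : ℝ)) := by
    refine Summable.tsum_le_tsum (fun n => ?_) hs (hsp.add hsum)
    have := residueClass_nonneg a n
    split_ifs
    · simp
    · rw [zero_div, zero_add]
      rcases n.eq_zero_or_pos with rfl | hn
      · simp
      · refine div_le_div_of_nonneg_left (residueClass_nonneg a _) (mod_cast hn) ?_
        conv_lhs => rw [← Real.rpow_one n]
        exact Real.rpow_le_rpow_of_exponent_le (by norm_cast) hx.1.le
  rw [hsp.tsum_add hsum] at h2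
  linarith

open ArithmeticFunction ArithmeticFunction.vonMangoldt Complex LSeries in
lemma aux_upper {q : ℕ} [NeZero q] {a : ZMod q} (ha : IsUnit a) :
    ∃ C : ℝ, ∀ x : ℝ, x ∈ Set.Ioc 1 2 →
       ∑' n, residueClass a n / (n : ℝ) ^ x ≤ (q.totient : ℝ)⁻¹ / (x - 1) + C := by
  have H {x : ℝ} (hx : 1 < x) :
      ∑' n, residueClass a n / (n : ℝ) ^ x =
        (LFunctionResidueClassAux a x).re + (q.totient : ℝ)⁻¹ / (x - 1) := by
    refine ofReal_injective ?_
    simp only [ofReal_tsum, ofReal_div, ofReal_cpow (Nat.cast_nonneg _), ofReal_natCast,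
      ofReal_add, ofReal_inv, ofReal_sub, ofReal_one]
    simp_rw [← LFunctionResidueClassAux_real ha hx,
      eqOn_LFunctionResidueClassAux ha <| Set.mem_ofPred.mpr (ofReal_re x ▸ hx), sub_add_cancel,
      LSeries, term]
    refine tsum_congr fun n ↦ ?_
    split_ifs with hn
    · simp only [hn, residueClass_apply_zero, ofReal_zero, zero_div]
    · rfl
  have : ContinuousOn (fun x : ℝ ↦ (LFunctionResidueClassAux a x).re) (Set.Icc 1 2) :=
    continuous_re.continuousOn.comp (t := Set.univ) (continuousOn_LFunctionResidueClassAux a)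
      (fun ⦃x⦄ a ↦ trivial) |>.comp continuous_ofReal.continuousOn fun x hx ↦ by
        simpa only [Set.mem_ofPred_eq, ofReal_re] using hx.1
  obtain ⟨C, hC⟩ := bddAbove_def.mp <| IsCompact.bddAbove_image isCompact_Icc this
  refine ⟨C, fun x hx ↦ ?_⟩
  rw [H hx.1, add_comm, add_le_add_iff_left]
  exact hC _ (Set.mem_image_of_mem (fun x : ℝ ↦ (LFunctionResidueClassAux a x).re)
    (Set.mem_Icc_of_Ioc hx))

open ArithmeticFunction ArithmeticFunction.vonMangoldt in
lemma aux_upper' : ∃ K : ℝ, ∀ x : ℝ, x ∈ Set.Ioc 1 2 →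
    (Summable fun n : ℕ => vonMangoldt n / (n : ℝ) ^ x) ∧
    ∑' n : ℕ, vonMangoldt n / (n : ℝ) ^ x ≤ 1 / (x - 1) + K := by
  have hr : ∀ n : ℕ, residueClass (1 : ZMod 1) n = vonMangoldt n := by
    intro n
    have : (n : ZMod 1) = 1 := Subsingleton.elim _ _
    simp [residueClass, this]
  obtain ⟨K, hK⟩ := aux_upper (q := 1) (a := 1) isUnit_one
  refine ⟨K, fun x hx => ?_⟩
  have h1 := hK x hx
  have h2 := aux_summable (1 : ZMod 1) hx.1
  simp only [hr, Nat.totient_one, Nat.cast_one, inv_one] at h1 h2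
  exact ⟨h2, h1⟩

lemma aux_abel (f h g : ℕ → ℝ) (hg : Antitone g) 
    (hfh : ∀ n, ∑ m ∈ Finset.range n, f m ≤ ∑ m ∈ Finset.range n, h m) (hg0 : ∀ n, 0 ≤ g n) (n : ℕ) :
    ∑ m ∈ Finset.range n, f m * g m ≤ ∑ m ∈ Finset.range n, h m * g m := by
  have key : ∀ n, g n * (∑ m ∈ Finset.range n, h m - ∑ m ∈ Finset.range n, f m) ≤
      ∑ m ∈ Finset.range n, h m * g m - ∑ m ∈ Finset.range n, f m * g m := by
    intro n
    induction n with
    | zero => simp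
    | succ n ih =>
      have h1 := hfh (n + 1)
      have h2 := hg (Nat.le_succ n)
      have h3 : g (n + 1) * (∑ m ∈ Finset.range (n + 1), h m - ∑ m ∈ Finset.range (n + 1), f m) ≤
        g n * (∑ m ∈ Finset.range (n + 1), h m - ∑ m ∈ Finset.range (n + 1), f m) :=
        mul_le_mul_of_nonneg_right h2 (by linarith)
      refine h3.trans ?_
      simp only [Finset.sum_range_succ]
      nlinarith
  have := key n
  have h2 : 0 ≤ g n * (∑ m ∈ Finset.range n, h m - ∑ m ∈ Finset.range n, f m) :=
    mul_nonneg (hg0 n) (by have := hfh n; linarith)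
  linarith

lemma aux_prod_totient (S : Finset ℕ) (hS : ∀ p ∈ S, p.Prime) :
    (Nat.totient (∏ p ∈ S, p) : ℝ) * (1 + ∑ p ∈ S, 1 / (p : ℝ)) ≤ ((∏ p ∈ S, p : ℕ) : ℝ) := by
  induction S using Finset.induction_on with
  | empty => simp
  | insert p S hp ih =>
    have hpp := hS p (by simp)
    have ih' := ih fun q hq => hS q (by simp [hq])
    have hcop : Nat.Coprime p (∏ q ∈ S, q) := by
      refine Nat.Coprime.prod_right fun q hq => ?_
      exact (Nat.coprime_primes hpp (hS q (by simp [hq]))).2 (by rintro rfl; exact hp hq)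
    rw [Finset.prod_insert hp, Finset.sum_insert hp, Nat.totient_mul hcop, Nat.totient_prime hpp]
    have hle : (Nat.totient (∏ p ∈ S, p) : ℝ) ≤ ((∏ p ∈ S, p : ℕ) : ℝ) := by
      exact_mod_cast Nat.totient_le _
    set φ := (Nat.totient (∏ p ∈ S, p) : ℝ)
    have hφ : 0 ≤ φ := Nat.cast_nonneg _
    push_cast [hpp.one_le] at hle ih' ⊢
    set M := ∏ p ∈ S, (p : ℝ)
    set σ := ∑ p ∈ S, 1 / (p : ℝ)
    have hp1 : (1 : ℝ) ≤ p := by exact_mod_cast hpp.one_le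
    have : ((p : ℝ) - 1) * φ * (1 + (1 / p + σ)) = (p - 1) * (φ * (1 + σ)) + (p - 1) / p * φ := by
      field_simp; ring
    rw [this]
    have h1 : ((p : ℝ) - 1) * (φ * (1 + σ)) ≤ (p - 1) * M := mul_le_mul_of_nonneg_left ih' (by linarith)
    have h2 : ((p : ℝ) - 1) / p ≤ 1 := by rw [div_le_one (by linarith)]; linarith
    nlinarith

lemma aux_exists_M (a : ℕ) (ha : 0 < a) (T : ℝ) :
    ∃ M : ℕ, 0 < M ∧ Nat.Coprime a M ∧ T * (Nat.totient M : ℝ) < M := by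
  have hns := not_summable_one_div_on_primes
  rw [not_summable_iff_tendsto_nat_atTop_of_nonneg (by
    intro n; apply Set.indicator_nonneg; intro _ _; positivity)] at hns
  set F : ℕ → ℝ := Set.indicator {p : ℕ | p.Prime} (fun n : ℕ => 1 / (n : ℝ)) with hF
  obtain ⟨n, hn⟩ := (hns.eventually_ge_atTop (T + ∑ i ∈ Finset.range (a + 1), F i)).exists
  set S := (Finset.range n).filter fun p => p.Prime ∧ a < p with hS
  have hSp : ∀ p ∈ S, p.Prime := fun p hp => (Finset.mem_filter.1 hp).2.1
  have hF0 : ∀ i, 0 ≤ F i := by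
    intro n; apply Set.indicator_nonneg; intro _ _; positivity
  have hle : ∑ i ∈ Finset.range n, F i ≤ ∑ i ∈ Finset.range (a + 1), F i + ∑ p ∈ S, 1 / (p : ℝ) := by
    have h1 : ∑ p ∈ S, 1 / (p : ℝ) = ∑ p ∈ S, F p := by
      refine Finset.sum_congr rfl fun p hp => ?_
      rw [hF, Set.indicator_of_mem (show p ∈ {p : ℕ | p.Prime} from hSp p hp)]
    rw [h1]
    rw [← Finset.sum_filter_add_sum_filter_not (Finset.range n) (fun p => p.Prime ∧ a < p) F, add_comm]
    refine add_le_add ?_ le_rfl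
    · rw [← Finset.sum_filter_add_sum_filter_not (Finset.filter _ _) (fun p => p ≤ a) F]
      rw [← add_zero (∑ i ∈ Finset.range (a + 1), F i)]
      apply add_le_add
      · refine Finset.sum_le_sum_of_subset_of_nonneg ?_ fun i _ _ => hF0 i
        intro i hi
        have := (Finset.mem_filter.1 hi).2
        exact Finset.mem_range.2 (by omega)
      · refine (Finset.sum_eq_zero fun i hi => ?_).le
        simp only [Finset.mem_filter] at hi
        rw [hF]
        refine Set.indicator_of_notMem (fun h : i.Prime => ?_) _
        exact hi.1.2 ⟨h, by omega⟩
  have hmain := aux_prod_totient S hSp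
  have hMpos : 0 < ∏ p ∈ S, p := Finset.prod_pos fun p hp => (hSp p hp).pos
  refine ⟨∏ p ∈ S, p, hMpos, ?_, ?_⟩
  · refine Nat.Coprime.prod_right fun p hp => ?_
    refine ((Nat.Prime.coprime_iff_not_dvd (hSp p hp)).2 fun h => ?_).symm
    have := Nat.le_of_dvd ha h
    have := (Finset.mem_filter.1 hp).2.2
    omega
  · refine lt_of_lt_of_le ?_ hmain
    have hφ : (0 : ℝ) < (Nat.totient (∏ p ∈ S, p) : ℝ) := by
      exact_mod_cast Nat.totient_pos.2 hMpos
    rw [mul_comm]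
    apply mul_lt_mul_of_pos_left _ hφ
    linarith

lemma aux_g_anti (s : ℝ) (hs : 1 < s) :
    Antitone (fun m : ℕ => Real.log (max (m : ℝ) 3) / (max (m : ℝ) 3) ^ s) := by
  intro m n hmn
  have h3 : ∀ m : ℕ, max (m : ℝ) 3 ∈ Set.Ici (Real.exp s⁻¹) := by
    intro m
    have h1 : s⁻¹ ≤ 1 := inv_le_one_of_one_le₀ hs.le
    have h2 := Real.exp_le_exp.2 h1
    have h4 := Real.exp_one_lt_d9
    have h5 : (3 : ℝ) ≤ max (m : ℝ) 3 := le_max_right _ _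
    rw [Set.mem_Ici]
    linarith
  exact Real.log_div_self_rpow_antitoneOn (by linarith) (h3 m) (h3 n)
    (max_le_max (by exact_mod_cast hmn) le_rfl)

lemma aux_g_nonneg (s : ℝ) (m : ℕ) : 0 ≤ Real.log (max (m : ℝ) 3) / (max (m : ℝ) 3) ^ s := by
  have h5 : (3 : ℝ) ≤ max (m : ℝ) 3 := le_max_right _ _
  have := Real.log_nonneg (show (1 : ℝ) ≤ max (m : ℝ) 3 by linarith)
  positivity

lemma aux_g_le (s : ℝ) (hs : 1 < s) (m : ℕ) :
    Real.log (max (m : ℝ) 3) / (max (m : ℝ) 3) ^ s ≤ 2 := by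
  refine (aux_g_anti s hs (Nat.zero_le m)).trans ?_
  simp only [Nat.cast_zero]
  rw [max_eq_right (by norm_num : (0 : ℝ) ≤ 3)]
  have h1 : Real.log 3 ≤ 3 - 1 := Real.log_le_sub_one_of_pos (by norm_num)
  have h2 : (1 : ℝ) ≤ 3 ^ s := Real.one_le_rpow (by norm_num) (by linarith)
  rw [div_le_iff₀ (by linarith)]
  linarith

lemma aux_g_prime (s : ℝ) (hs : 1 < s) (hs2 : s ≤ 2) (M q m : ℕ) (hM : 2 ≤ M) (hq : q.Prime)
    (hm : m + 1 = M * q) :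
    Real.log (max (m : ℝ) 3) / (max (m : ℝ) 3) ^ s ≤
      (if m < M * M then 2 else 0) +
        8 / (M : ℝ) * (ArithmeticFunction.vonMangoldt q / (q : ℝ) ^ s) := by
  rw [ArithmeticFunction.vonMangoldt_apply_prime hq]
  have hq1 : (2 : ℝ) ≤ q := by exact_mod_cast hq.two_le
  have hM1 : (2 : ℝ) ≤ M := by exact_mod_cast hM
  have hlq : 0 ≤ Real.log q := Real.log_nonneg (by linarith)
  split_ifs with h
  · have := aux_g_le s hs m
    have h2 : 0 ≤ 8 / (M : ℝ) * (Real.log q / (q : ℝ) ^ s) := by positivity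
    linarith
  · rw [zero_add]
    push Not at h
    have hMq : M ≤ q := by
      by_contra hlt
      push Not at hlt
      have : M * q ≤ M * M := Nat.mul_le_mul_left _ hlt.le
      nlinarith
    have hMq' : (M : ℝ) ≤ q := by exact_mod_cast hMq
    have hm3 : (3 : ℝ) ≤ m := by
      have : 3 ≤ m := by nlinarith
      exact_mod_cast this
    rw [max_eq_left hm3]
    have hm' : (m : ℝ) + 1 = M * q := by exact_mod_cast hm
    have h1 : Real.log m ≤ 2 * Real.log q := by
      have e1 : Real.log m ≤ Real.log (M * q) := Real.log_le_log (by linarith) (by linarith)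
      rw [Real.log_mul (by linarith) (by linarith)] at e1
      have e2 : Real.log M ≤ Real.log q := Real.log_le_log (by linarith) hMq'
      linarith
    have h2 : (M : ℝ) * (q : ℝ) ^ s / 4 ≤ (m : ℝ) ^ s := by
      have e1 : ((M : ℝ) * q / 2) ^ s ≤ (m : ℝ) ^ s :=
        Real.rpow_le_rpow (by positivity) (by nlinarith) (by linarith)
      rw [Real.div_rpow (by positivity) (by norm_num), Real.mul_rpow (by positivity) (by positivity)] at e1
      refine le_trans ?_ e1
      have e2 : (M : ℝ) ≤ (M : ℝ) ^ s := by
        conv_lhs => rw [← Real.rpow_one (M : ℝ)]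
        exact Real.rpow_le_rpow_of_exponent_le (by linarith) hs.le
      have e3 : (2 : ℝ) ^ s ≤ 4 := by
        have := Real.rpow_le_rpow_of_exponent_le (show (1 : ℝ) ≤ 2 by norm_num) hs2
        norm_num at this
        exact this
      have e4 : (0 : ℝ) ≤ (q : ℝ) ^ s := by positivity
      exact div_le_div₀ (by positivity) (mul_le_mul_of_nonneg_right e2 e4) (by positivity) e3
    have hqs : 0 < (q : ℝ) ^ s := by positivity
    calc Real.log m / (m : ℝ) ^ s ≤ (2 * Real.log q) / ((M : ℝ) * (q : ℝ) ^ s / 4) :=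
          div_le_div₀ (by positivity) h1 (by positivity) h2
      _ = 8 / (M : ℝ) * (Real.log q / (q : ℝ) ^ s) := by field_simp; ring

open Finset in
lemma aux_h_sum (s : ℝ) (hs : 1 < s) (hs2 : s ≤ 2) (M N : ℕ) (hM : 2 ≤ M)
    (hsum : Summable fun n : ℕ => ArithmeticFunction.vonMangoldt n / (n : ℝ) ^ s) :
    ∑ m ∈ range N with M ∣ m + 1 ∧ ((m + 1) / M).Prime,
        Real.log (max (m : ℝ) 3) / (max (m : ℝ) 3) ^ s ≤
      2 * (M : ℝ) ^ 2 + 8 / (M : ℝ) * ∑' n : ℕ, ArithmeticFunction.vonMangoldt n / (n : ℝ) ^ s := by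
  set P := (range N).filter (fun m => M ∣ m + 1 ∧ ((m + 1) / M).Prime) with hP
  have hPm : ∀ m ∈ P, M * ((m + 1) / M) = m + 1 ∧ ((m + 1) / M).Prime := by
    intro m hm
    have := (mem_filter.1 hm).2
    exact ⟨Nat.mul_div_cancel' this.1, this.2⟩
  have h1 : ∑ m ∈ P, Real.log (max (m : ℝ) 3) / (max (m : ℝ) 3) ^ s ≤
      ∑ m ∈ P, ((if m < M * M then (2 : ℝ) else 0) +
        8 / (M : ℝ) * (ArithmeticFunction.vonMangoldt ((m + 1) / M) / (((m + 1) / M : ℕ) : ℝ) ^ s)) := by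
    refine sum_le_sum fun m hm => ?_
    exact aux_g_prime s hs hs2 M _ m hM (hPm m hm).2 (hPm m hm).1.symm
  refine h1.trans ?_
  rw [sum_add_distrib]
  refine add_le_add ?_ ?_
  · rw [← sum_filter, sum_const, nsmul_eq_mul, mul_comm]
    refine mul_le_mul_of_nonneg_left ?_ (by norm_num)
    have : #(P.filter fun m => m < M * M) ≤ #(range (M * M)) :=
      card_le_card fun m hm => mem_range.2 (mem_filter.1 hm).2
    rw [card_range] at this
    rw [sq]
    exact_mod_cast this
  · rw [← mul_sum]
    refine mul_le_mul_of_nonneg_left ?_ (by positivity)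
    have hinj : Set.InjOn (fun m => (m + 1) / M) (P : Set ℕ) := by
      intro m hm n hn hmn
      have e1 := (hPm m hm).1
      have e2 := (hPm n hn).1
      simp only at hmn
      rw [hmn] at e1
      omega
    rw [← sum_image (f := fun q : ℕ => ArithmeticFunction.vonMangoldt q / (q : ℝ) ^ s) hinj]
    refine hsum.sum_le_tsum _ fun i _ => ?_
    have : 0 ≤ ArithmeticFunction.vonMangoldt i := ArithmeticFunction.vonMangoldt_nonneg
    positivity

open Finset ArithmeticFunction.vonMangoldt in
lemma aux_supply_analytic (Q M C B D : ℕ) [NeZero Q] (c : ZMod Q) (hc : IsUnit c) (hM : 2 ≤ M)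
    (hQ : 8 * (C : ℝ) / M < (Q.totient : ℝ)⁻¹)
    (hcon : ∀ x : ℕ, #((range (x + 1)).filter fun p : ℕ => p.Prime ∧ (p : ZMod Q) = c ∧ B < p) ≤
      C * #{m ∈ range (x + 1) | M ∣ m + 1 ∧ ((m + 1) / M).Prime} + D) : False := by
  obtain ⟨K1, hK1⟩ := aux_lower hc
  obtain ⟨K3, hK3⟩ := aux_upper'
  set K4 : ℝ := ∑ m ∈ range (max B 3 + 1), Λ m with hK4
  set f : ℕ → ℝ := fun m => if m.Prime ∧ (m : ZMod Q) = c ∧ B < m then 1 else 0 with hf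
  set h : ℕ → ℝ := fun m => C * (if M ∣ m + 1 ∧ ((m + 1) / M).Prime then 1 else 0) +
    (if m = 0 then (D : ℝ) else 0) with hh
  have hfh : ∀ n, ∑ m ∈ range n, f m ≤ ∑ m ∈ range n, h m := by
    intro n
    cases n with
    | zero => simp
    | succ x =>
      have := hcon x
      simp only [hf, hh, sum_add_distrib, ← mul_sum, sum_boole, sum_ite_eq']
      rw [if_pos (by simp)]
      exact_mod_cast this
  have hmain : ∀ s : ℝ, s ∈ Set.Ioc (1 : ℝ) 2 → (Q.totient : ℝ)⁻¹ / (s - 1) - K1 ≤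
      C * (2 * (M : ℝ) ^ 2 + 8 / (M : ℝ) * (1 / (s - 1) + K3)) + D * 2 + K4 := by
    intro s hs
    refine (hK1 s hs).trans ?_
    obtain ⟨hsum, hle⟩ := hK3 s hs
    set g : ℕ → ℝ := fun m => Real.log (max (m : ℝ) 3) / (max (m : ℝ) 3) ^ s with hg
    have hg0 : ∀ m, 0 ≤ g m := aux_g_nonneg s
    refine Real.tsum_le_of_sum_range_le (fun n => ?_) fun n => ?_
    · have := residueClass_nonneg c n
      split_ifs <;> positivity
    have hterm : ∀ m : ℕ, (if m.Prime then residueClass c m else 0) / (m : ℝ) ^ s ≤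
        f m * g m + (if m < max B 3 + 1 then Λ m else 0) := by
      intro m
      have hL : 0 ≤ Λ m := ArithmeticFunction.vonMangoldt_nonneg
      have hf0 : 0 ≤ f m := by simp only [hf]; split_ifs <;> norm_num
      have hR : 0 ≤ f m * g m + (if m < max B 3 + 1 then Λ m else 0) := by
        have := mul_nonneg hf0 (hg0 m)
        split_ifs <;> linarith
      by_cases hp : m.Prime
      swap
      · rw [if_neg hp, zero_div]; exact hR
      by_cases hmc : (m : ZMod Q) = c
      swap
      · rw [if_pos hp, residueClass, Set.indicator_of_notMem (by exact hmc), zero_div]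
        exact hR
      rw [if_pos hp, residueClass, Set.indicator_of_mem (by exact hmc)]
      have hm1 : (1 : ℝ) ≤ m := by exact_mod_cast hp.one_le
      split_ifs with hlt
      · have : (1 : ℝ) ≤ (m : ℝ) ^ s := Real.one_le_rpow hm1 (by linarith [hs.1])
        have h2 : Λ m / (m : ℝ) ^ s ≤ Λ m := div_le_self hL this
        have := mul_nonneg hf0 (hg0 m)
        linarith
      · have hB : B < m := by omega
        have h3 : 3 ≤ m := by omega
        have h3' : (3 : ℝ) ≤ m := by exact_mod_cast h3
        simp only [hf, hg]
        rw [if_pos ⟨hp, hmc, hB⟩, max_eq_left h3', ArithmeticFunction.vonMangoldt_apply_prime hp]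
        simp
    refine (sum_le_sum fun m _ => hterm m).trans ?_
    rw [sum_add_distrib]
    refine add_le_add ?_ ?_
    · refine (aux_abel f h g (aux_g_anti s hs.1) hfh hg0 n).trans ?_
      simp only [hh, add_mul, sum_add_distrib, mul_assoc, ← mul_sum, ite_mul, one_mul, zero_mul]
      rw [← sum_filter]
      refine add_le_add ?_ ?_
      · refine mul_le_mul_of_nonneg_left ?_ (Nat.cast_nonneg _)
        refine (aux_h_sum s hs.1 hs.2 M n hM hsum).trans ?_
        have : 8 / (M : ℝ) * ∑' n : ℕ, Λ n / (n : ℝ) ^ s ≤ 8 / (M : ℝ) * (1 / (s - 1) + K3) :=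
          mul_le_mul_of_nonneg_left hle (by positivity)
        linarith
      · rw [sum_ite_eq']
        split_ifs
        · exact mul_le_mul_of_nonneg_left (aux_g_le s hs.1 0) (Nat.cast_nonneg _)
        · positivity
    · rw [← sum_filter, hK4]
      refine sum_le_sum_of_subset_of_nonneg ?_ fun i _ _ => ArithmeticFunction.vonMangoldt_nonneg
      intro m hm
      exact mem_range.2 (mem_filter.1 hm).2
  set A : ℝ := (Q.totient : ℝ)⁻¹ - 8 * (C : ℝ) / M with hA
  have hA0 : 0 < A := by linarith
  set K : ℝ := C * (2 * (M : ℝ) ^ 2 + 8 / (M : ℝ) * K3) + D * 2 + K4 + K1 with hK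
  have hfin : ∀ δ : ℝ, 0 < δ → δ ≤ 1 → A ≤ K * δ := by
    intro δ h0 h1
    have := hmain (1 + δ) ⟨by linarith, by linarith⟩
    rw [show 1 + δ - 1 = δ by ring] at this
    rw [← div_le_iff₀ h0, hA, hK, sub_div]
    have e : 8 * (C : ℝ) / M / δ = C * (8 / (M : ℝ) * (1 / δ)) := by ring
    rw [e]
    linarith
  have h1 := hfin 1 one_pos le_rfl
  have hKpos : 0 < K := by linarith
  have h2 := hfin (A / (2 * K)) (by positivity) (by rw [div_le_one (by positivity)]; linarith)
  have : K * (A / (2 * K)) = A / 2 := by field_simp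
  linarith

open Finset in
lemma aux_supply (a b : ℕ) (ha : 0 < a) (hab : Nat.Coprime a b) (C B : ℕ) :
    ∃ M x : ℕ, 0 < M ∧ C * (#{q ∈ range ((x + 1) / M + 1) | q.Prime} + M + 2) ≤
      #{p ∈ range (x + 1) | p.Prime ∧ B < p ∧ p ≡ b [MOD a] ∧ M ∣ p + 1} := by
  obtain ⟨M, hM0, haM, hM⟩ := aux_exists_M a ha (8 * C * a.totient + 1)
  have hφM : (1 : ℝ) ≤ M.totient := by exact_mod_cast Nat.totient_pos.2 hM0
  have hφa : (1 : ℝ) ≤ a.totient := by exact_mod_cast Nat.totient_pos.2 ha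
  have hM2 : 2 ≤ M := by
    have : (1 : ℝ) < M := by
      have : (0 : ℝ) ≤ 8 * C * a.totient := by positivity
      nlinarith
    exact_mod_cast this
  by_contra! hcon
  obtain ⟨c, hca, hcM⟩ := Nat.chineseRemainder haM b (M - 1)
  have hQ : NeZero (a * M) := ⟨by positivity⟩
  have hc1 : Nat.Coprime c a := by
    have := hca.gcd_eq
    rw [Nat.gcd_comm b a, hab] at this
    exact this
  have hc2 : Nat.Coprime c M := by
    have := hcM.gcd_eq
    rw [Nat.Coprime, this]
    obtain ⟨M', rfl⟩ : ∃ M', M = M' + 1 := ⟨M - 1, by omega⟩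
    simp
  have hcu : IsUnit (c : ZMod (a * M)) := (ZMod.isUnit_iff_coprime _ _).2 (hc1.mul_right hc2)
  refine aux_supply_analytic (a * M) M C B (C * (M + 2)) (c : ZMod (a * M)) hcu hM2 ?_ ?_
  · rw [Nat.totient_mul haM]
    push_cast
    rw [div_lt_iff₀ (by positivity), inv_mul_eq_div, lt_div_iff₀ (by positivity)]
    nlinarith
  · intro x
    have h1 := hcon M x hM0
    have h2 : #((range (x + 1)).filter fun p : ℕ => p.Prime ∧ (p : ZMod (a * M)) = c ∧ B < p) ≤
        #{p ∈ range (x + 1) | p.Prime ∧ B < p ∧ p ≡ b [MOD a] ∧ M ∣ p + 1} := by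
      refine card_le_card fun p hp => ?_
      rw [mem_filter] at hp ⊢
      obtain ⟨hx, hp, hpc, hB⟩ := hp
      rw [ZMod.natCast_eq_natCast_iff] at hpc
      refine ⟨hx, hp, hB, (hpc.of_mul_right M).trans hca, ?_⟩
      have h3 : p ≡ M - 1 [MOD M] := (hpc.of_mul_left a).trans hcM
      have h4 := h3.add_right 1
      rw [Nat.sub_add_cancel hM0] at h4
      exact (Nat.modEq_zero_iff_dvd.1 (h4.trans (by simp [Nat.ModEq])))
    have h3 : #{q ∈ range ((x + 1) / M + 1) | q.Prime} ≤
        #{m ∈ range (x + 1) | M ∣ m + 1 ∧ ((m + 1) / M).Prime} := by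
      refine card_le_card_of_injOn (fun q => M * q - 1) ?_ ?_
      · intro q hq
        have hq := mem_filter.1 hq
        have hqle : q ≤ (x + 1) / M := by have := mem_range.1 hq.1; omega
        have hpos : 0 < M * q := Nat.mul_pos hM0 hq.2.pos
        have e : M * q - 1 + 1 = M * q := Nat.sub_add_cancel hpos
        have hle : M * q ≤ x + 1 := (Nat.mul_le_mul_left M hqle).trans (Nat.mul_div_le _ _)
        simp only [coe_filter, Set.mem_ofPred_eq, mem_range, e]
        refine ⟨by omega, Dvd.intro _ rfl, ?_⟩
        rw [Nat.mul_div_cancel_left _ hM0]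
        exact hq.2
      · intro q hq r hr hqr
        have hq := (mem_filter.1 hq).2
        have hr := (mem_filter.1 hr).2
        have hpos : 0 < M * q := Nat.mul_pos hM0 hq.pos
        have hpos' : 0 < M * r := Nat.mul_pos hM0 hr.pos
        simp only at hqr
        exact Nat.eq_of_mul_eq_mul_left hM0 (by omega)
    have h4 := Nat.mul_le_mul_left C h3
    nlinarith

lemma aux_kth_power (k n : ℕ) (hn : n ≠ 0) (h : ∀ q, q.Prime → k ∣ n.factorization q) :
    ∃ c, n = c ^ k := by
  refine ⟨∏ q ∈ n.primeFactors, q ^ (n.factorization q / k), ?_⟩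
  rw [← Finset.prod_pow]
  conv_lhs => rw [← Nat.prod_factorization_pow_eq_self hn]
  rw [Finsupp.prod, Nat.support_factorization]
  refine Finset.prod_congr rfl fun q hq => ?_
  rw [← pow_mul, Nat.div_mul_cancel (h q (Nat.prime_of_mem_primeFactors hq))]

lemma aux_sigma_prod (t : Finset ℕ) (ht : ∀ p ∈ t, p.Prime) :
    ArithmeticFunction.sigma 1 (∏ p ∈ t, p) = ∏ p ∈ t, (p + 1) := by
  induction t using Finset.induction_on with
  | empty => simp
  | insert p t hp ih =>
    have hpp := ht p (by simp)
    have hcop : Nat.Coprime p (∏ q ∈ t, q) := by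
      refine Nat.Coprime.prod_right fun q hq => ?_
      exact (Nat.coprime_primes hpp (ht q (by simp [hq]))).2 (by rintro rfl; exact hp hq)
    rw [Finset.prod_insert hp, Finset.prod_insert hp,
      ArithmeticFunction.isMultiplicative_sigma.map_mul_of_coprime hcop,
      ih fun q hq => ht q (by simp [hq])]
    congr 1
    rw [ArithmeticFunction.sigma_one_apply, hpp.sum_divisors]

open Finset in
theorem sigma_kth_power_b_mod_a (a b k : ℕ) (ha : 0 < a) (hb : 0 < b)
    (hab : Nat.Coprime a b) (hk : 2 ≤ k)
    (hord : Nat.Coprime (orderOf (b : ZMod a)) k) :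
    {n : ℕ | n ≡ b [MOD a] ∧ ∃ c : ℕ, ArithmeticFunction.sigma 1 (n) = c ^ k}.Infinite := by
  have hane : NeZero a := ⟨ha.ne'⟩
  have hkne : NeZero k := ⟨by omega⟩
  have hbu : IsUnit (b : ZMod a) := (ZMod.isUnit_iff_coprime _ _).2 hab.symm
  have hopos : 0 < orderOf (b : ZMod a) := by
    obtain ⟨u, hu⟩ := hbu
    rw [← hu, orderOf_units]
    exact orderOf_pos u
  set o := orderOf (b : ZMod a) with ho
  obtain ⟨C, hC⟩ := aux_comb k (o * (k + 1)) hk (by positivity) (by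
    refine Nat.Coprime.mul_left hord ?_
    simp)
  refine Set.infinite_of_forall_exists_gt fun B => ?_
  obtain ⟨M, x, hM, hle⟩ := aux_supply a b ha hab C B
  set U := (range (x + 1)).filter fun p => p.Prime ∧ B < p ∧ p ≡ b [MOD a] ∧ M ∣ p + 1 with hU
  set QQ : Finset ℕ := (range ((x + 1) / M + 1)).filter (fun q => q.Prime) ∪ range (M + 1) with hQQ
  have hQcard : #QQ ≤ #{q ∈ range ((x + 1) / M + 1) | q.Prime} + (M + 1) := by
    refine (card_union_le _ _).trans ?_
    rw [card_range]
  obtain ⟨t, htU, hsum, hcard⟩ := hC (QQ → ZMod k) #QQ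
    (fun g => by ext i; simp)
    (by simp [ZMod.card]) ℕ (fun p q => ((p + 1).factorization q : ZMod k)) U
    ((Nat.mul_le_mul_left C (by omega)).trans hle)
  have hU' : ∀ p ∈ t, p.Prime ∧ B < p ∧ p ≡ b [MOD a] ∧ M ∣ p + 1 ∧ p ≤ x := by
    intro p hp
    have := mem_filter.1 (htU hp)
    have h1 := mem_range.1 this.1
    exact ⟨this.2.1, this.2.2.1, this.2.2.2.1, this.2.2.2.2, by omega⟩
  have htne : t.Nonempty := by
    rw [nonempty_iff_ne_empty]
    rintro rfl
    rw [card_empty] at hcard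
    have h1 : k + 1 ∣ 1 := (Dvd.intro_left o rfl).trans (Nat.modEq_zero_iff_dvd.1 hcard.symm)
    have := Nat.le_of_dvd one_pos h1
    omega
  refine ⟨∏ p ∈ t, p, ⟨?_, ?_⟩, ?_⟩
  · rw [← ZMod.natCast_eq_natCast_iff]
    push_cast
    have h1 : ∏ p ∈ t, (p : ZMod a) = ∏ p ∈ t, (b : ZMod a) :=
      prod_congr rfl fun p hp => (ZMod.natCast_eq_natCast_iff _ _ _).2 (hU' p hp).2.2.1
    rw [h1, prod_const]
    have h2 : #t ≡ 1 [MOD o] := hcard.of_mul_right (k + 1)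
    rw [← pow_mod_orderOf, ← ho, h2, ho, pow_mod_orderOf, pow_one]
  · rw [aux_sigma_prod t fun p hp => (hU' p hp).1]
    refine aux_kth_power k _ (prod_ne_zero_iff.2 fun p _ => by omega) fun q hq => ?_
    rw [Nat.factorization_prod fun p _ => by omega, Finsupp.finsetSum_apply]
    by_cases hqQ : q ∈ QQ
    · have := congrFun hsum ⟨q, hqQ⟩
      rw [Finset.sum_apply] at this
      rw [← ZMod.natCast_eq_zero_iff]
      push_cast
      exact this
    · rw [sum_eq_zero]
      · exact dvd_zero k
      intro p hp
      apply Nat.factorization_eq_zero_of_not_dvd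
      intro hdvd
      apply hqQ
      obtain ⟨_, _, _, ⟨e, he⟩, hx⟩ := hU' p hp
      rw [he] at hdvd
      have he0 : 0 < e := by
        rcases e.eq_zero_or_pos with rfl | h
        · omega
        · exact h
      rw [hQQ, mem_union]
      rcases (Nat.Prime.dvd_mul hq).1 hdvd with h | h
      · right
        have := Nat.le_of_dvd hM h
        exact mem_range.2 (by omega)
      · left
        have := Nat.le_of_dvd he0 h
        have h2 : e ≤ (x + 1) / M := by
          rw [Nat.le_div_iff_mul_le hM, mul_comm]
          omega
        exact mem_filter.2 ⟨mem_range.2 (by omega), hq⟩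
  · obtain ⟨p, hp⟩ := htne
    refine (hU' p hp).2.1.trans_le ?_
    exact Nat.le_of_dvd (prod_pos fun p hp => (hU' p hp).1.pos) (dvd_prod_of_mem _ hp)
end

section
/- Let a ≥ 1, b ≥ 0, and k ≥ 2 be integers. Then either σ(an+b) is not a perfect k-th power for any natural number n ≥ 1, or σ(an+b) is a perfect k-th power for infinitely many natural numbers n. -/
/-- Choosing constants which kill most characters. -/
lemma exists_killing {G ι : Type*} [AddCommGroup G] [Fintype G]
    (K : ℕ) (hK : 0 < K) (hG : ∀ g : G, K • g = 0) (f : ι → G) (s : Finset ι) :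
    ∃ (a : ι → ℂ) (X : Finset (AddChar G ℂ)), (∀ i, a i ≠ 0) ∧
      (∀ χ, χ ∈ X ∨ ∃ i ∈ s, χ (f i) = a i) ∧
      (X.card : ℝ) ≤ (1 - 1 / (K : ℝ)) ^ s.card * Fintype.card G := by
  classical
  induction s using Finset.induction_on with
  | empty => exact ⟨fun _ => 1, Finset.univ, by simp, by simp, by simp⟩
  | insert i s hi ih =>
    obtain ⟨a, X, ha, hX, hc⟩ := ih
    have hKR : (0 : ℝ) < K := by exact_mod_cast hK
    have hcard : (Polynomial.nthRootsFinset K (1 : ℂ)).card = K :=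
      (Complex.isPrimitiveRoot_exp K hK.ne').card_nthRootsFinset
    obtain ⟨y, hy, hyc⟩ := Finset.exists_le_card_fiber_of_nsmul_le_card_of_maps_to
      (s := X) (t := Polynomial.nthRootsFinset K (1 : ℂ)) (f := fun χ => χ (f i))
      (b := (X.card : ℝ) / K)
      (by
        intro χ _
        rw [Polynomial.mem_nthRootsFinset hK, ← AddChar.map_nsmul_eq_pow, hG]
        simp)
      (by rw [← Finset.card_pos, hcard]; exact hK)
      (by rw [hcard, nsmul_eq_mul, mul_div_cancel₀ _ hKR.ne'])
    rw [Polynomial.mem_nthRootsFinset hK] at hy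
    refine ⟨Function.update a i y, X.filter (fun χ => ¬ χ (f i) = y), ?_, ?_, ?_⟩
    · intro j
      by_cases hj : j = i
      · subst hj
        simp only [Function.update_self]
        rintro rfl
        simp [hK.ne'] at hy
      · simp [Function.update_of_ne hj, ha]
    · intro χ
      by_cases h : χ (f i) = y
      · exact Or.inr ⟨i, Finset.mem_insert_self _ _, by simpa using h⟩
      · rcases hX χ with h1 | ⟨j, hj, h1⟩
        · exact Or.inl (Finset.mem_filter.mpr ⟨h1, h⟩)
        · refine Or.inr ⟨j, Finset.mem_insert_of_mem hj, ?_⟩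
          rw [Function.update_of_ne, h1]
          rintro rfl
          exact hi hj
    · rw [Finset.card_insert_of_notMem hi]
      have h1 := Finset.card_filter_add_card_filter_not (s := X) (fun χ => χ (f i) = y)
      have h2 : ((X.filter (fun χ => χ (f i) = y)).card : ℝ)
        + ((X.filter (fun χ => ¬ χ (f i) = y)).card : ℝ) = X.card := by exact_mod_cast h1
      have h3 : (0 : ℝ) ≤ 1 - 1 / K := by
        rw [sub_nonneg, div_le_one hKR]; exact_mod_cast hK
      calc ((X.filter (fun χ => ¬ χ (f i) = y)).card : ℝ)
          ≤ (1 - 1 / K) * X.card := by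
            have : (1 - 1 / (K : ℝ)) * X.card = X.card - X.card / K := by ring
            rw [this]; linarith
        _ ≤ (1 - 1 / K) * ((1 - 1 / (K : ℝ)) ^ s.card * Fintype.card G) := by gcongr
        _ = _ := by ring

/-- Van Emde Boas–Kruyswijk / Meshulam bound for the Davenport constant. -/
lemma davenport {G ι : Type*} [AddCommGroup G] [Fintype G]
    (K : ℕ) (hK : 0 < K) (hG : ∀ g : G, K • g = 0) (f : ι → G) (s : Finset ι)
    (hs : (K : ℝ) * Real.log (Fintype.card G) < s.card) :
    ∃ t ⊆ s, t.Nonempty ∧ ∑ i ∈ t, f i = 0 := by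
  classical
  obtain ⟨a, X, ha, hX, hc⟩ := exists_killing K hK hG f s
  have hKR : (0 : ℝ) < K := by exact_mod_cast hK
  have hGpos : (0 : ℝ) < Fintype.card G := by exact_mod_cast Fintype.card_pos
  have h3 : (0 : ℝ) ≤ 1 - 1 / K := by
    rw [sub_nonneg, div_le_one hKR]; exact_mod_cast hK
  have hlt : (1 - 1 / (K : ℝ)) ^ s.card * Fintype.card G < 1 := by
    have h4 : (1 - 1 / (K : ℝ)) ^ s.card ≤ Real.exp (-(s.card / K)) := by
      calc (1 - 1 / (K : ℝ)) ^ s.card ≤ (Real.exp (-(1 / K))) ^ s.card := by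
            gcongr; exact Real.one_sub_le_exp_neg _
        _ = _ := by rw [← Real.exp_nat_mul]; congr 1; ring
    have h5 : Real.exp (-(s.card / K)) < (Fintype.card G : ℝ)⁻¹ := by
      rw [← Real.exp_log (inv_pos.mpr hGpos), Real.exp_lt_exp, Real.log_inv, neg_lt_neg_iff,
        lt_div_iff₀ hKR]
      linarith
    calc _ < (Fintype.card G : ℝ)⁻¹ * Fintype.card G := by
          have := h4.trans_lt h5
          gcongr
      _ = 1 := inv_mul_cancel₀ hGpos.ne'
  have hempty : ∀ χ : AddChar G ℂ, ∃ i ∈ s, χ (f i) = a i := by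
    have h6 := hc.trans_lt hlt
    have h7 : X.card = 0 := by
      rw [← Nat.lt_one_iff]; exact_mod_cast h6
    rw [Finset.card_eq_zero] at h7
    intro χ
    simpa [h7] using hX χ
  by_contra hcon
  push Not at hcon
  have hzero : ∑ χ : AddChar G ℂ, ∏ i ∈ s, (a i - χ (f i)) = 0 := by
    refine Finset.sum_eq_zero fun χ _ => ?_
    obtain ⟨i, hi, h⟩ := hempty χ
    exact Finset.prod_eq_zero hi (by rw [h, sub_self])
  have hprod : ∀ (χ : AddChar G ℂ) (t : Finset ι), ∏ i ∈ t, χ (f i) = χ (∑ i ∈ t, f i) := by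
    intro χ t
    induction t using Finset.induction_on with
    | empty => simp
    | insert i t hi ih => rw [Finset.prod_insert hi, Finset.sum_insert hi, ih, AddChar.map_add_eq_mul]
  simp_rw [Finset.prod_sub, hprod] at hzero
  rw [Finset.sum_comm] at hzero
  simp_rw [← Finset.mul_sum, AddChar.sum_apply_eq_ite] at hzero
  rw [Finset.sum_eq_single ∅] at hzero
  · simp [Finset.prod_eq_zero_iff, ha] at hzero
  · intro t ht hne
    rw [if_neg, mul_zero]
    exact hcon t (Finset.mem_powerset.mp ht) (Finset.nonempty_iff_ne_empty.mpr hne)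
  · simp

lemma abel_compare (a b g : ℕ → ℝ) (hg : Antitone g) (hg0 : ∀ n, 0 ≤ g n)
    (h : ∀ n, ∑ i ∈ Finset.range n, a i ≤ ∑ i ∈ Finset.range n, b i) (n : ℕ) :
    ∑ i ∈ Finset.range n, a i * g i ≤ ∑ i ∈ Finset.range n, b i * g i := by
  have key : ∀ n, g n * (∑ i ∈ Finset.range n, b i - ∑ i ∈ Finset.range n, a i) ≤
      ∑ i ∈ Finset.range n, b i * g i - ∑ i ∈ Finset.range n, a i * g i := by
    intro n
    induction n with
    | zero => simp
    | succ n ih =>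
      have h1 := hg (Nat.le_succ n)
      have h2 := h (n + 1)
      have h3 := mul_le_mul_of_nonneg_right h1 (sub_nonneg.mpr h2)
      simp only [Finset.sum_range_succ, Nat.succ_eq_add_one] at *
      nlinarith
  have := key n
  have h2 := mul_nonneg (hg0 n) (sub_nonneg.mpr (h n))
  linarith

lemma dirichlet_abel (a : ℕ → ℝ) (ha : ∀ n, 0 ≤ a n) (ha0 : a 0 = 0) (c K : ℝ) (hc : 0 ≤ c)
    (hK : 0 ≤ K)
    (h : ∀ n : ℕ, ∑ i ∈ Finset.range (n + 1), a i ≤ c * n + K) (x : ℝ) (hx : 1 < x) :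
    ∑' n : ℕ, a n / (n : ℝ) ^ x ≤ c * ∑' n : ℕ, 1 / (n : ℝ) ^ x + K := by
  have hsum : Summable (fun n : ℕ => 1 / (n : ℝ) ^ x) := Real.summable_one_div_nat_rpow.mpr hx
  have hx0 : x ≠ 0 := by linarith
  have hbound : ∀ n, ∑ i ∈ Finset.range n, a i / (i : ℝ) ^ x
      ≤ c * ∑' n : ℕ, 1 / (n : ℝ) ^ x + K := by
    intro n
    rcases n with _ | n
    · simp
      have : 0 ≤ ∑' n : ℕ, ((n : ℝ) ^ x)⁻¹ := tsum_nonneg fun n => by positivity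
      positivity
    have h1 := abel_compare (fun i => a (i + 1)) (fun i => c + if i = 0 then K else 0)
      (fun i => 1 / ((i : ℝ) + 1) ^ x)
      (by
        intro i j hij
        have : (i : ℝ) ≤ j := by exact_mod_cast hij
        have hx' : 0 ≤ x := by linarith
        dsimp only
        gcongr)
      (fun i => by positivity)
      (by
        intro m
        rcases m with _ | m
        · simp
        have := h (m + 1)
        rw [Finset.sum_range_succ', ha0, add_zero] at this
        refine this.trans (le_of_eq ?_)
        rw [Finset.sum_add_distrib, Finset.sum_ite_eq' (Finset.range (m + 1)) 0]
        simp [mul_comm]) n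
    rw [Finset.sum_range_succ', ha0, zero_div, add_zero]
    have h2 : ∑ i ∈ Finset.range n, a (i + 1) / ((i + 1 : ℕ) : ℝ) ^ x
        = ∑ i ∈ Finset.range n, a (i + 1) * (1 / ((i : ℝ) + 1) ^ x) := by
      refine Finset.sum_congr rfl fun i _ => ?_
      push_cast
      ring
    rw [h2]
    refine h1.trans ?_
    simp only [add_mul, Finset.sum_add_distrib]
    refine add_le_add ?_ ?_
    · rw [← Finset.mul_sum]
      refine mul_le_mul_of_nonneg_left ?_ hc
      have h3 := hsum.sum_le_tsum (Finset.range (n + 1)) (fun i _ => by positivity)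
      rw [Finset.sum_range_succ'] at h3
      simpa [Real.zero_rpow hx0] using h3
    · rcases n with _ | n
      · simpa using hK
      · rw [Finset.sum_range_succ']
        simp
  have hs : Summable (fun n : ℕ => a n / (n : ℝ) ^ x) :=
    summable_of_sum_range_le (fun n => div_nonneg (ha n) (by positivity)) hbound
  exact hs.tsum_le_of_sum_range_le hbound

open ArithmeticFunction ArithmeticFunction.vonMangoldt in
/-- Primes in a residue class have positive upper density relative to all primes. -/
lemma theta_residue_large (q : ℕ) [NeZero q] (a : ZMod q) (ha : IsUnit a) (c : ℝ) (hc : 0 ≤ c)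
    (hcq : c < (q.totient : ℝ)⁻¹) (K : ℝ) :
    ∃ n : ℕ, c * n + K <
      ∑ p ∈ (Finset.range (n + 1)).filter (fun p : ℕ => p.Prime ∧ (p : ZMod q) = a), Real.log p := by
  wlog hK : 0 ≤ K generalizing K
  · obtain ⟨n, hn⟩ := this 0 le_rfl
    exact ⟨n, by linarith⟩
  by_contra hcon
  push Not at hcon
  set A : ℕ → ℝ := fun n => if n.Prime then residueClass a n else 0 with hA
  set B : ℕ → ℝ := fun n => if n.Prime then 0 else residueClass a n with hB
  have hA0 : ∀ n, 0 ≤ A n := fun n => by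
    simp only [hA]; split_ifs; exacts [residueClass_nonneg a n, le_rfl]
  have hB0 : ∀ n, 0 ≤ B n := fun n => by
    simp only [hB]; split_ifs; exacts [le_rfl, residueClass_nonneg a n]
  have hAB : ∀ n, residueClass a n = A n + B n := fun n => by
    simp only [hA, hB]; split_ifs <;> simp
  have hAsum : ∀ n : ℕ, ∑ i ∈ Finset.range (n + 1), A i ≤ c * n + K := by
    intro n
    refine le_trans (le_of_eq ?_) (hcon n)
    rw [Finset.sum_filter]
    refine Finset.sum_congr rfl fun p _ => ?_
    simp only [hA]
    by_cases hp : p.Prime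
    · by_cases hpa : (p : ZMod q) = a
      · simp [hp, hpa, residueClass, vonMangoldt_apply_prime hp]
      · simp [hp, hpa, residueClass]
    · simp [hp]
  obtain ⟨C, hC⟩ := LSeries_residueClass_lower_bound ha
  have hBs : Summable (fun n : ℕ => B n / n) := summable_residueClass_non_primes_div a
  set C2 := ∑' n : ℕ, B n / n with hC2
  have main : ∀ x ∈ Set.Ioc (1 : ℝ) 2, (q.totient : ℝ)⁻¹ ≤
      c * ((x - 1) * ∑' n : ℕ, 1 / (n : ℝ) ^ x) + (K + C2 + C) * (x - 1) := by
    intro x hx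
    have h1 := hC hx
    have hx1 : 0 < x - 1 := sub_pos.mpr hx.1
    have hle : ∀ n : ℕ, B n / (n : ℝ) ^ x ≤ B n / n := by
      intro n
      rcases n.eq_zero_or_pos with rfl | hn
      · simp [hB]
      · refine div_le_div_of_nonneg_left (hB0 _) (mod_cast hn) ?_
        conv_lhs => rw [← Real.rpow_one n]
        exact Real.rpow_le_rpow_of_exponent_le (by exact_mod_cast hn) hx.1.le
    have hBx : Summable (fun n : ℕ => B n / (n : ℝ) ^ x) :=
      hBs.of_nonneg_of_le (fun n => div_nonneg (hB0 n) (by positivity)) hle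
    have hR : Summable (fun n : ℕ => residueClass a n / (n : ℝ) ^ x) :=
      LSeries.summable_real_of_abscissaOfAbsConv_lt <|
        (abscissaOfAbsConv_residueClass_le_one a).trans_lt <| mod_cast hx.1
    have hAx : Summable (fun n : ℕ => A n / (n : ℝ) ^ x) := by
      refine hR.of_nonneg_of_le (fun n => div_nonneg (hA0 n) (by positivity)) fun n => ?_
      rw [hAB, add_div]
      have : 0 ≤ B n / (n : ℝ) ^ x := div_nonneg (hB0 n) (by positivity)
      linarith
    have h2 : ∑' n : ℕ, residueClass a n / (n : ℝ) ^ x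
        = ∑' n : ℕ, A n / (n : ℝ) ^ x + ∑' n : ℕ, B n / (n : ℝ) ^ x := by
      rw [← hAx.tsum_add hBx]
      refine tsum_congr fun n => ?_
      rw [hAB, add_div]
    have h3 := dirichlet_abel A hA0 (by simp [hA]) c K hc hK hAsum x hx.1
    have h4 : ∑' n : ℕ, B n / (n : ℝ) ^ x ≤ C2 := hBx.tsum_le_tsum hle hBs
    have h5 : (q.totient : ℝ)⁻¹ / (x - 1) ≤ c * ∑' n : ℕ, 1 / (n : ℝ) ^ x + K + C2 + C := by
      linarith
    rw [div_le_iff₀ hx1] at h5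
    linarith
  have hlim : Filter.Tendsto (fun x : ℝ => c * ((x - 1) * ∑' n : ℕ, 1 / (n : ℝ) ^ x)
      + (K + C2 + C) * (x - 1)) (nhdsWithin 1 (Set.Ioi 1))
      (nhds (c * 1 + (K + C2 + C) * (1 - 1))) := by
    refine (tendsto_sub_mul_tsum_nat_rpow.const_mul c).add (Filter.Tendsto.const_mul _ ?_)
    exact (Filter.Tendsto.sub_const (Filter.tendsto_id.mono_left nhdsWithin_le_nhds) 1)
  have hfin : (q.totient : ℝ)⁻¹ ≤ c * 1 + (K + C2 + C) * (1 - 1) := by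
    refine ge_of_tendsto hlim ?_
    filter_upwards [Ioc_mem_nhdsGT (show (1 : ℝ) < 2 by norm_num)] with x hx using main x hx
  linarith

lemma exists_totient_small (T : ℝ) (q : ℕ) (hq : 0 < q) :
    ∃ Q : ℕ, q ∣ Q ∧ 0 < Q ∧ T * Q.totient < Q := by
  have hns := not_summable_one_div_on_primes
  have hnn : ∀ n, 0 ≤ ({p | Nat.Prime p}.indicator (fun n : ℕ => 1 / (n : ℝ))) n := fun n =>
    Set.indicator_nonneg (fun _ _ => by positivity) n
  have ht := (not_summable_iff_tendsto_nat_atTop_of_nonneg hnn).mp hns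
  obtain ⟨N, hN⟩ := (ht.eventually_gt_atTop (Real.log (max T 1))).exists
  refine ⟨q * N.factorial, Dvd.intro _ rfl, Nat.mul_pos hq N.factorial_pos, ?_⟩
  set Q := q * N.factorial with hQdef
  have hQ : 0 < Q := Nat.mul_pos hq N.factorial_pos
  have hQR : (0 : ℝ) < Q := by exact_mod_cast hQ
  have h1 : (Q.totient : ℝ) = Q * ∏ p ∈ Q.primeFactors, (1 - (p : ℝ)⁻¹) := by
    have := Nat.totient_eq_mul_prod_factors Q
    have h := congrArg (fun x : ℚ => (x : ℝ)) this
    push_cast at h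
    exact h
  have h2 : ∏ p ∈ Q.primeFactors, (1 - (p : ℝ)⁻¹) ≤ Real.exp (-∑ p ∈ Q.primeFactors, (p : ℝ)⁻¹) := by
    rw [← Finset.sum_neg_distrib, Real.exp_sum]
    refine Finset.prod_le_prod (fun p hp => ?_) fun p _ => Real.one_sub_le_exp_neg _
    have : (1 : ℝ) ≤ p := by exact_mod_cast (Nat.prime_of_mem_primeFactors hp).one_le
    rw [sub_nonneg]
    exact inv_le_one_of_one_le₀ this
  have h3 : Real.log (max T 1) < ∑ p ∈ Q.primeFactors, (p : ℝ)⁻¹ := by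
    refine hN.trans_le ?_
    rw [Finset.sum_indicator_eq_sum_filter]
    simp only [one_div]
    refine Finset.sum_le_sum_of_subset_of_nonneg ?_ (fun _ _ _ => by positivity)
    intro p hp
    simp only [Finset.mem_filter, Finset.mem_range, Set.mem_ofPred_eq] at hp
    rw [Nat.mem_primeFactors]
    exact ⟨hp.2, Dvd.dvd.mul_left (Nat.dvd_factorial hp.2.pos hp.1.le) q, hQ.ne'⟩
  have hmax : 0 < max T 1 := lt_max_of_lt_right one_pos
  have h4 : Real.exp (-∑ p ∈ Q.primeFactors, (p : ℝ)⁻¹) < (max T 1)⁻¹ := by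
    rw [← Real.exp_log (inv_pos.mpr hmax), Real.exp_lt_exp, Real.log_inv]
    linarith
  have h5 : (Q.totient : ℝ) < Q * (max T 1)⁻¹ := by
    rw [h1]
    exact mul_lt_mul_of_pos_left (h2.trans_lt h4) hQR
  calc T * Q.totient ≤ max T 1 * Q.totient := by gcongr; exact le_max_left _ _
    _ < max T 1 * (Q * (max T 1)⁻¹) := by gcongr
    _ = Q := by field_simp

lemma many_primes (D : ℝ) (hD : 0 ≤ D) (q : ℕ) (hq : 0 < q) :
    ∃ Q n : ℕ, q ∣ Q ∧ 0 < Q ∧ Q ≤ (n + 1) / Q ∧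
      D * (((n + 1) / Q).primeCounting + 1) <
        ((Finset.range (n + 1)).filter (fun p : ℕ => p.Prime ∧ (p : ZMod Q) = -1)).card := by
  obtain ⟨Q, hqQ, hQ, hT⟩ := exists_totient_small (24 * D) q hq
  have : NeZero Q := ⟨hQ.ne'⟩
  have hQR : (0 : ℝ) < Q := by exact_mod_cast hQ
  have hφ : (0 : ℝ) < Q.totient := by exact_mod_cast Nat.totient_pos.mpr hQ
  -- eventual inequality
  have hev : ∀ᶠ x : ℝ in Filter.atTop,
      (⌊x⌋₊.primeCounting : ℝ) ≤ 2 * x / Real.log x ∧ (Q : ℝ) + 1 ≤ x ∧ 3 ≤ x := by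
    have h4 : Real.log 4 < 2 := by
      have : Real.log 4 = 2 * Real.log 2 := by
        rw [show (4 : ℝ) = 2 ^ 2 by norm_num, Real.log_pow]; norm_num
      have := Real.log_two_lt_d9
      linarith
    have h1 := Chebyshev.eventually_primeCounting_le (ε := 2 - Real.log 4) (by linarith)
    filter_upwards [h1, Filter.eventually_ge_atTop ((Q : ℝ) + 1), Filter.eventually_ge_atTop 3]
      with x h1 h2 h3
    refine ⟨?_, h2, h3⟩
    simpa using h1
  have htend : Filter.Tendsto (fun n : ℕ => ((n + 1 : ℕ) : ℝ) / Q) Filter.atTop Filter.atTop :=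
    ((tendsto_natCast_atTop_atTop (R := ℝ)).comp (Filter.tendsto_add_atTop_nat 1)).atTop_div_const hQR
  obtain ⟨n0, hn0⟩ := Filter.eventually_atTop.mp (htend.eventually hev)
  set A : ℕ → Finset ℕ := fun n =>
    (Finset.range (n + 1)).filter (fun p : ℕ => p.Prime ∧ (p : ZMod Q) = -1) with hA
  have hlogn : ∀ p : ℕ, 0 ≤ Real.log p := fun p => Real.log_natCast_nonneg p
  obtain ⟨n, hn⟩ := theta_residue_large Q (-1) (by simp) ((2 * Q.totient : ℝ)⁻¹) (by positivity)
    (by rw [inv_lt_inv₀ (by positivity) hφ]; linarith)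
    (∑ p ∈ A n0, Real.log p)
  have hnn0 : n0 ≤ n := by
    by_contra hlt
    push Not at hlt
    have hsub : A n ⊆ A n0 := by
      refine Finset.filter_subset_filter _ ?_
      intro i hi
      simp only [Finset.mem_range] at *
      omega
    have := Finset.sum_le_sum_of_subset_of_nonneg hsub (f := fun p : ℕ => Real.log p)
      (fun p _ _ => hlogn p)
    have h0 : (0 : ℝ) ≤ (2 * Q.totient : ℝ)⁻¹ * n := by positivity
    linarith
  obtain ⟨h1, h2, h3⟩ := hn0 n hnn0
  rw [Nat.floor_div_eq_div] at h1
  set x : ℝ := ((n + 1 : ℕ) : ℝ) / Q with hx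
  have hQx : (Q : ℝ) * x = n + 1 := by rw [hx]; push_cast; field_simp
  have hQ1 : (1 : ℝ) ≤ Q := by exact_mod_cast hQ
  refine ⟨Q, n, hqQ, hQ, ?_, ?_⟩
  · rw [Nat.le_div_iff_mul_le hQ]
    have : (Q : ℝ) * Q ≤ n + 1 := by
      rw [← hQx]; gcongr; linarith
    exact_mod_cast this
  have hn2 : (2 : ℝ) ≤ n := by nlinarith
  have hnpos : (0 : ℝ) < n := by linarith
  have hlogpos : 0 < Real.log n := Real.log_pos (by linarith)
  have hcard : ∑ p ∈ A n, Real.log p ≤ (A n).card * Real.log n := by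
    rw [← nsmul_eq_mul]
    refine Finset.sum_le_card_nsmul _ _ _ fun p hp => ?_
    simp only [hA, Finset.mem_filter, Finset.mem_range] at hp
    refine Real.log_le_log (by exact_mod_cast hp.2.1.pos) ?_
    exact_mod_cast Nat.lt_succ_iff.mp hp.1
  have h0 : 0 ≤ ∑ p ∈ A n0, Real.log p := Finset.sum_nonneg fun p _ => hlogn p
  have hlower : (2 * Q.totient : ℝ)⁻¹ * n < (A n).card * Real.log n := by linarith
  have hxpos : 0 < x := by linarith
  have hlogx : 0 < Real.log x := Real.log_pos (by linarith)
  have hlog : Real.log n ≤ 2 * Real.log x := by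
    have : Real.log n ≤ Real.log (Q * x) := Real.log_le_log hnpos (by rw [hQx]; linarith)
    rw [Real.log_mul hQR.ne' hxpos.ne'] at this
    have : Real.log Q ≤ Real.log x := Real.log_le_log hQR (by linarith)
    linarith
  have hupper : ((((n + 1) / Q).primeCounting : ℝ) + 1) * Real.log n ≤ 12 * n / Q := by
    calc ((((n + 1) / Q).primeCounting : ℝ) + 1) * Real.log n
        ≤ (2 * x / Real.log x + 1) * (2 * Real.log x) := by gcongr
      _ = 4 * x + 2 * Real.log x := by field_simp; ring
      _ ≤ 6 * x := by
        have := Real.log_le_sub_one_of_pos hxpos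
        linarith
      _ = 6 * (n + 1) / Q := by rw [← hQx]; field_simp
      _ ≤ 12 * n / Q := by
        refine div_le_div_of_nonneg_right ?_ hQR.le
        linarith
  have hfinal : D * (12 * n / Q) ≤ (2 * Q.totient : ℝ)⁻¹ * n := by
    rw [inv_mul_eq_div, le_div_iff₀ (by positivity)]
    have : D * (12 * n / Q) * (2 * Q.totient) = n * ((24 * D * Q.totient) / Q) := by ring
    rw [this]
    have : 24 * D * Q.totient / Q ≤ 1 := by rw [div_le_one hQR]; exact hT.le
    nlinarith
  have : D * ((((n + 1) / Q).primeCounting : ℝ) + 1) * Real.log n < (A n).card * Real.log n := by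
    rw [mul_assoc]
    exact ((mul_le_mul_of_nonneg_left hupper hD).trans hfinal).trans_lt hlower
  exact lt_of_mul_lt_mul_right this hlogpos.le

lemma eq_pow_of_dvd_factorization (S K : ℕ) (hS : S ≠ 0)
    (h : ∀ p, p.Prime → K ∣ S.factorization p) : ∃ w, S = w ^ K := by
  refine ⟨S.factorization.prod fun p e => p ^ (e / K), ?_⟩
  conv_lhs => rw [← Nat.prod_factorization_pow_eq_self hS]
  rw [Finsupp.prod, Finsupp.prod, ← Finset.prod_pow]
  refine Finset.prod_congr rfl fun p hp => ?_
  rw [← pow_mul, Nat.div_mul_cancel (h p (Nat.prime_of_mem_primeFactors (by simpa using hp)))]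

lemma exists_good_multiplier (k q : ℕ) (hk : 1 ≤ k) (hq : 0 < q) :
    ∃ M : ℕ, 1 < M ∧ M ≡ 1 [MOD q] ∧ ∃ w, ArithmeticFunction.sigma 1 M = w ^ k := by
  set K := 2 * k with hKdef
  have hK : 0 < K := by omega
  have : NeZero K := ⟨hK.ne'⟩
  have hlogK : 0 ≤ Real.log K := Real.log_natCast_nonneg K
  obtain ⟨Q, n, hqQ, hQ, hQy, hcard⟩ := many_primes (K * Real.log K) (by positivity) q hq
  set y := (n + 1) / Q with hy
  set A := (Finset.range (n + 1)).filter (fun p : ℕ => p.Prime ∧ (p : ZMod Q) = -1) with hA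
  set I : Finset ℕ := insert 0 (Nat.primesLE y) with hI
  have hIcard : I.card = y.primeCounting + 1 := by
    rw [hI, Finset.card_insert_of_notMem, Nat.primesLE_card_eq_primeCounting]
    simp [Nat.mem_primesLE, Nat.not_prime_zero]
  let f : ℕ → (I → ZMod K) := fun p l =>
    if (l : ℕ) = 0 then 1 else (((p + 1).factorization (l : ℕ) : ℕ) : ZMod K)
  obtain ⟨t, htA, htne, hsum⟩ := davenport (G := I → ZMod K) K hK
    (fun g => by ext l; simp) f A (by
      have h1 : Fintype.card (I → ZMod K) = K ^ (y.primeCounting + 1) := by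
        simp [ZMod.card, hIcard]
      rw [h1]
      push_cast
      rw [Real.log_pow]
      push_cast
      refine lt_of_eq_of_lt ?_ hcard
      ring)
  have hprime : ∀ p ∈ t, p.Prime := fun p hp => (Finset.mem_filter.mp (htA hp)).2.1
  have hmod : ∀ p ∈ t, (p : ZMod Q) = -1 := fun p hp => (Finset.mem_filter.mp (htA hp)).2.2
  have hle : ∀ p ∈ t, p ≤ n := fun p hp => by
    have := (Finset.mem_filter.mp (htA hp)).1
    rw [Finset.mem_range] at this
    omega
  have heven : K ∣ t.card := by
    have h0 := congrFun hsum ⟨0, by simp [hI]⟩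
    simp only [Finset.sum_apply, f, if_true, Finset.sum_const, nsmul_eq_mul, mul_one,
      Pi.zero_apply] at h0
    exact (ZMod.natCast_eq_zero_iff _ _).mp h0
  refine ⟨∏ p ∈ t, p, ?_, ?_, ?_⟩
  · obtain ⟨p, hp⟩ := htne
    have h1 : p ∣ ∏ p ∈ t, p := Finset.dvd_prod_of_mem _ hp
    have h2 : 0 < ∏ p ∈ t, p := Finset.prod_pos fun p hp => (hprime p hp).pos
    exact (hprime p hp).one_lt.trans_le (Nat.le_of_dvd h2 h1)
  · refine Nat.ModEq.of_dvd hqQ ?_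
    rw [← ZMod.natCast_eq_natCast_iff]
    push_cast
    rw [Finset.prod_congr rfl hmod, Finset.prod_const]
    exact Even.neg_one_pow (even_iff_two_dvd.mpr ((Dvd.intro k rfl).trans heven))
  · have hsig : ArithmeticFunction.sigma 1 (∏ p ∈ t, p) = ∏ p ∈ t, (p + 1) := by
      rw [ArithmeticFunction.isMultiplicative_sigma.map_prod_of_prime t hprime]
      refine Finset.prod_congr rfl fun p hp => ?_
      rw [ArithmeticFunction.sigma_one_apply, (hprime p hp).sum_divisors]
    rw [hsig]
    obtain ⟨w, hw⟩ := eq_pow_of_dvd_factorization (∏ p ∈ t, (p + 1)) K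
      (Finset.prod_ne_zero_iff.mpr fun p _ => by omega) (by
        intro l hl
        rw [Nat.factorization_prod (fun p _ => by omega), Finsupp.finsetSum_apply]
        by_cases hly : l ≤ y
        · have h0 := congrFun hsum ⟨l, by simp [hI, Nat.mem_primesLE, hly, hl]⟩
          simp only [Finset.sum_apply, f, hl.ne_zero, if_false, Pi.zero_apply] at h0
          rw [← Nat.cast_sum] at h0
          exact (ZMod.natCast_eq_zero_iff _ _).mp h0
        · refine Finset.dvd_sum fun p hp => ?_
          rw [Nat.factorization_eq_zero_of_not_dvd]
          · exact dvd_zero _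
          intro hdvd
          have hQp : Q ∣ p + 1 := by
            rw [← ZMod.natCast_eq_zero_iff]
            push_cast
            rw [hmod p hp]
            ring
          obtain ⟨u, hu⟩ := hQp
          have hupos : 0 < u := by
            rcases Nat.eq_zero_or_pos u with rfl | h
            · simp at hu
            · exact h
          have huy : u ≤ y := by
            rw [hy, Nat.le_div_iff_mul_le hQ, mul_comm, ← hu]
            have := hle p hp
            omega
          rw [hu, hl.dvd_mul] at hdvd
          rcases hdvd with h | h
          · exact hly ((Nat.le_of_dvd hQ h).trans hQy)
          · exact hly ((Nat.le_of_dvd hupos h).trans huy))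
    exact ⟨w ^ 2, by rw [hw, hKdef, pow_mul]⟩

theorem sigma_kth_power_dichotomy (a b k : ℕ) (ha : 1 ≤ a) (hk : 2 ≤ k) :
    (∀ n : ℕ, 1 ≤ n → ¬ ∃ c : ℕ, ArithmeticFunction.sigma 1 (a * n + b) = c ^ k) ∨
    {n : ℕ | 1 ≤ n ∧ ∃ c : ℕ, ArithmeticFunction.sigma 1 (a * n + b) = c ^ k}.Infinite := by
  by_cases hex : ∃ n : ℕ, 1 ≤ n ∧ ∃ c : ℕ, ArithmeticFunction.sigma 1 (a * n + b) = c ^ k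
  swap
  · left
    intro n hn hc
    exact hex ⟨n, hn, hc⟩
  right
  obtain ⟨n₁, hn₁⟩ := hex
  have step : ∀ n ∈ {n : ℕ | 1 ≤ n ∧ ∃ c : ℕ, ArithmeticFunction.sigma 1 (a * n + b) = c ^ k},
      ∃ m ∈ {n : ℕ | 1 ≤ n ∧ ∃ c : ℕ, ArithmeticFunction.sigma 1 (a * n + b) = c ^ k}, n < m := by
    rintro n ⟨hn, c, hc⟩
    set N := a * n + b with hN
    have hNpos : 0 < N := by
      have := Nat.mul_pos ha hn
      omega
    obtain ⟨M, hM1, hMmod, w, hw⟩ := exists_good_multiplier k (a * N) (by omega)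
      (Nat.mul_pos ha hNpos)
    obtain ⟨j, hj⟩ := (Nat.modEq_iff_dvd' hM1.le).mp hMmod.symm
    have hMj : M = a * N * j + 1 := by omega
    have hjpos : 0 < j := by
      rcases Nat.eq_zero_or_pos j with rfl | h
      · omega
      · exact h
    have hcop : Nat.Coprime N M := by
      rw [hMj, show a * N * j + 1 = 1 + N * (a * j) by ring]
      simp
    refine ⟨n + N * N * j, ⟨by omega, c * w, ?_⟩, ?_⟩
    · have : a * (n + N * N * j) + b = N * M := by
        rw [hMj]
        have : a * (n + N * N * j) + b = (a * n + b) + a * (N * N * j) := by ring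
        rw [this, ← hN]
        ring
      rw [this, ArithmeticFunction.isMultiplicative_sigma.map_mul_of_coprime hcop, hc, hw, mul_pow]
    · have := Nat.mul_pos (Nat.mul_pos hNpos hNpos) hjpos
      omega
  intro hfin
  obtain ⟨m, hm, hmax⟩ := hfin.exists_maximal ⟨n₁, hn₁⟩
  obtain ⟨m', hm', hlt⟩ := step m hm
  exact absurd (hmax hm' hlt.le) (not_le.mpr hlt)
end

section
/- Let k ≥ 2 and t be relatively prime positive integers, let S be a nonempty finite set of primes, and let A be a finite set of natural numbers all of whose prime factors lie in S. If |A| ≥ ⌈5k²t²(|S|·Ω(k)+Ω(t))·log(3kt(|S|·Ω(k)+Ω(t)))⌉, then there exists a nonempty subset A' ⊆ A such that the product of the elements of A' is a perfect k-th power and |A'| ≡ 1 (mod t). -/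
open Finset in
/-- number of indices on which a character is nontrivial -/
noncomputable def suppCard {H ι : Type} [AddCommGroup H] [Fintype ι] (a : ι → H)
    (χ : AddChar H ℂ) : ℕ := by
  classical exact (univ.filter (fun i => χ (a i) ≠ 1)).card

open Finset in
/-- characters trivial on K -/
noncomputable def ann {H : Type} [AddCommGroup H] [Finite H] (K : AddSubgroup H) :
    Finset (AddChar H ℂ) := by
  classical exact univ.filter (fun χ => ∀ x ∈ K, χ x = 1)

lemma mem_ann {H : Type} [AddCommGroup H] [Finite H] (K : AddSubgroup H) (χ : AddChar H ℂ) :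
    χ ∈ ann K ↔ ∀ x ∈ K, χ x = 1 := by
  simp [ann]

lemma card_ann_le {H : Type} [AddCommGroup H] [Finite H] (K : AddSubgroup H) :
    (ann K).card ≤ K.index := by
  classical
  have : Fintype (H ⧸ K) := Fintype.ofFinite _
  have h1 : ann K ⊆ Finset.univ.image
      (fun ψ : AddChar (H ⧸ K) ℂ => ψ.compAddMonoidHom (QuotientAddGroup.mk' K)) := by
    intro χ hχ
    rw [mem_ann] at hχ
    rw [Finset.mem_image]
    let f : H ⧸ K →+ Additive ℂ := QuotientAddGroup.lift K χ.toAddMonoidHom (by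
      intro x hx
      simpa using hχ x hx)
    refine ⟨AddChar.toAddMonoidHomEquiv.symm f, Finset.mem_univ _, ?_⟩
    ext x
    simp [f]
  calc (ann K).card ≤ _ := Finset.card_le_card h1
    _ ≤ _ := Finset.card_image_le
    _ = K.index := by
      rw [Finset.card_univ, AddChar.card_eq, AddSubgroup.index, Nat.card_eq_fintype_card]

lemma le_pow_length {d n : ℕ} (hd : d ≠ 0) (h : ∀ p, p.Prime → p ∣ d → p ≤ n) :
    d ≤ n ^ d.primeFactorsList.length := by
  conv_lhs => rw [← Nat.prod_primeFactorsList hd]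
  apply List.prod_le_pow_card
  intro p hp
  exact h p (Nat.prime_of_mem_primeFactorsList hp) (Nat.dvd_of_mem_primeFactorsList hp)

lemma length_mul {m n : ℕ} (hm : m ≠ 0) (hn : n ≠ 0) :
    (m * n).primeFactorsList.length = m.primeFactorsList.length + n.primeFactorsList.length :=
  ArithmeticFunction.cardFactors_mul hm hn

lemma length_lt_of_lt {H : Type} [AddCommGroup H] [Finite H] {K L : AddSubgroup H} (h : K < L) :
    L.index.primeFactorsList.length < K.index.primeFactorsList.length := by
  have h1 := AddSubgroup.relIndex_mul_index h.le
  have h0 : L.index ≠ 0 := AddSubgroup.index_ne_zero_of_finite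
  have h0' : K.index ≠ 0 := AddSubgroup.index_ne_zero_of_finite
  have h2 : K.relIndex L ≠ 0 := by
    intro h; rw [h] at h1; omega
  have h3 : K.relIndex L ≠ 1 := by
    rw [Ne, AddSubgroup.relIndex_eq_one]; exact not_le_of_gt h
  rw [← h1, length_mul h2 h0]
  have : 0 < (K.relIndex L).primeFactorsList.length := by
    rw [← ArithmeticFunction.cardFactors_apply, ArithmeticFunction.cardFactors_pos_iff_one_lt]; omega
  omega

open Finset in
lemma sum_supp {H ι : Type} [AddCommGroup H] [Finite H] [Fintype ι] [DecidableEq ι] (a : ι → H)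
    (K : AddSubgroup H) [DecidablePred (fun i => a i ∉ K)] (y : ℝ) :
    ∑ χ ∈ ann K, (suppCard a χ : ℝ) * y ^ suppCard a χ =
      ∑ i ∈ univ.filter (fun i => a i ∉ K), (∑ χ ∈ ann K, y ^ suppCard a χ -
        ∑ χ ∈ ann (K ⊔ AddSubgroup.zmultiples (a i)), y ^ suppCard a χ) := by
  classical
  have h1 : ∀ i, ∑ χ ∈ ann K, y ^ suppCard a χ -
        ∑ χ ∈ ann (K ⊔ AddSubgroup.zmultiples (a i)), y ^ suppCard a χ
        = ∑ χ ∈ ann K, (if χ (a i) ≠ 1 then y ^ suppCard a χ else 0) := by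
    intro i
    have : ann (K ⊔ AddSubgroup.zmultiples (a i)) = (ann K).filter (fun χ => ¬ χ (a i) ≠ 1) := by
      ext χ
      rw [mem_filter, mem_ann, mem_ann, not_not]
      constructor
      · intro h
        exact ⟨fun x hx => h x (AddSubgroup.mem_sup_left hx),
          h _ (AddSubgroup.mem_sup_right (AddSubgroup.mem_zmultiples _))⟩
      · rintro ⟨h, h'⟩ x hx
        obtain ⟨u, hu, v, hv, rfl⟩ := AddSubgroup.mem_sup.1 hx
        obtain ⟨z, rfl⟩ := AddSubgroup.mem_zmultiples_iff.1 hv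
        rw [AddChar.map_add_eq_mul, h u hu, AddChar.map_zsmul_eq_zpow, h']
        simp
    rw [this, ← sum_filter_add_sum_filter_not (ann K) (fun χ => χ (a i) ≠ 1), sum_filter]
    ring
  simp_rw [h1]
  rw [sum_comm]
  apply sum_congr rfl
  intro χ hχ
  rw [mem_ann] at hχ
  rw [sum_ite, sum_const_zero, add_zero, sum_const, nsmul_eq_mul]
  congr 3
  rw [suppCard, filter_filter]
  apply congrArg
  ext i
  simp only [mem_filter, mem_univ, true_and]
  exact ⟨fun h => ⟨fun h' => h (hχ _ h'), h⟩, fun h => h.2⟩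

open Finset in
lemma core_bound {H ι : Type} [AddCommGroup H] [Finite H] [Fintype ι] [DecidableEq ι] (a : ι → H)
    (m n : ℕ) (hn : 1 ≤ n) (hp : ∀ p, p.Prime → p ∣ Nat.card H → p ≤ n)
    (hcond : ∀ K : AddSubgroup H, ∀ [DecidablePred (fun i => a i ∉ K)],
      m * K.index.primeFactorsList.length ≤ (univ.filter (fun i => a i ∉ K)).card) :
    ∀ w : ℕ, ∀ K : AddSubgroup H, K.index.primeFactorsList.length = w →
    ∀ c : ℝ, 0 < c → c ≤ 1 →
    ∑ χ ∈ ann K, c ^ suppCard a χ ≤ (1 + ((n : ℝ) - 1) * c ^ m) ^ w := by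
  classical
  intro w
  induction w using Nat.strong_induction_on with
  | _ w ih =>
  intro K hK c hc0 hc1
  have hn' : (1 : ℝ) ≤ n := by exact_mod_cast hn
  set N := (univ.filter (fun i => a i ∉ K)).card with hN
  have hwN : m * w ≤ N := by rw [← hK]; exact hcond K
  set g : ℝ → ℝ := fun y => 1 + ((n : ℝ) - 1) * y ^ m with hg
  set F : ℝ → ℝ := fun y => ∑ χ ∈ ann K, y ^ suppCard a χ with hF
  have hg1 : ∀ y, 0 < y → 1 ≤ g y := by
    intro y hy
    have : 0 ≤ ((n : ℝ) - 1) * y ^ m := mul_nonneg (by linarith) (by positivity)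
    simp only [hg]; linarith
  set F' : ℝ → ℝ := fun y => ∑ χ ∈ ann K, (suppCard a χ : ℝ) * y ^ (suppCard a χ - 1) with hF'
  have hdF : ∀ y, HasDerivAt F (F' y) y := by
    intro y
    apply HasDerivAt.fun_sum
    intro χ _
    exact hasDerivAt_pow _ y
  set g' : ℝ → ℝ := fun y => ((n : ℝ) - 1) * (m * y ^ (m - 1)) with hg'
  have hdg : ∀ y, HasDerivAt g (g' y) y := by
    intro y
    exact ((hasDerivAt_pow m y).const_mul _).const_add _
  have hmulpow : ∀ (y : ℝ) (s : ℕ), y * ((s : ℝ) * y ^ (s - 1)) = s * y ^ s := by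
    intro y s
    cases s with
    | zero => simp
    | succ s => simp [pow_succ]; ring
  have hyF : ∀ y, 0 < y → y ≤ 1 → (N : ℝ) * (F y - g y ^ (w - 1)) ≤ y * F' y := by
    intro y hy hy1
    have : y * F' y = ∑ χ ∈ ann K, (suppCard a χ : ℝ) * y ^ suppCard a χ := by
      simp only [hF', mul_sum, hmulpow]
    rw [this, sum_supp, hN, ← nsmul_eq_mul, ← sum_const]
    apply sum_le_sum
    intro i hi
    have hi' : a i ∉ K := by simpa using hi
    have hlt : K < K ⊔ AddSubgroup.zmultiples (a i) := by
      refine lt_of_le_of_ne le_sup_left ?_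
      intro h
      apply hi'
      rw [h]
      exact AddSubgroup.mem_sup_right (AddSubgroup.mem_zmultiples _)
    have hl := length_lt_of_lt hlt
    rw [hK] at hl
    have := ih _ hl (K ⊔ AddSubgroup.zmultiples (a i)) rfl y hy hy1
    have h2 : g y ^ (K ⊔ AddSubgroup.zmultiples (a i)).index.primeFactorsList.length
        ≤ g y ^ (w - 1) := pow_le_pow_right₀ (hg1 y hy) (by omega)
    have h3 := this.trans h2
    simp only [hF]
    linarith
  have hyg : ∀ y, 0 < y → y * (w * g y ^ (w - 1) * g' y) ≤ N * (g y ^ w - g y ^ (w - 1)) := by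
    intro y hy
    have e1 : y * (w * g y ^ (w - 1) * g' y) = (m * w : ℕ) * (g y ^ (w - 1) * (g y - 1)) := by
      simp only [hg', hg]
      have := hmulpow y m
      push_cast
      linear_combination (w * (1 + ((n : ℝ) - 1) * y ^ m) ^ (w - 1) * ((n : ℝ) - 1)) * this
    rw [e1]
    by_cases hw : w = 0
    · subst hw; simp
    · have e2 : g y ^ w = g y ^ (w - 1) * g y := by
        rw [← pow_succ]; congr 1; omega
      rw [e2, show g y ^ (w - 1) * g y - g y ^ (w - 1) = g y ^ (w - 1) * (g y - 1) by ring]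
      have := hg1 y hy
      apply mul_le_mul_of_nonneg_right (by exact_mod_cast hwN)
      exact mul_nonneg (by positivity) (by linarith)
  set φ : ℝ → ℝ := fun y => (g y ^ w - F y) / y ^ N with hφ
  have hdφ : ∀ y, 0 < y → HasDerivAt φ (((w * g y ^ (w - 1) * g' y - F' y) * y ^ N -
      (g y ^ w - F y) * (N * y ^ (N - 1))) / (y ^ N) ^ 2) y := by
    intro y hy
    exact (((hdg y).pow w).sub (hdF y)).div (hasDerivAt_pow N y) (by positivity)
  have hanti : AntitoneOn φ (Set.Icc c 1) := by
    apply antitoneOn_of_deriv_nonpos (convex_Icc c 1)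
    · intro y hy
      exact (hdφ y (lt_of_lt_of_le hc0 hy.1)).continuousAt.continuousWithinAt
    · intro y hy
      rw [interior_Icc] at hy
      exact (hdφ y (hc0.trans hy.1)).differentiableAt.differentiableWithinAt
    · intro y hy
      rw [interior_Icc] at hy
      have hy0 := hc0.trans hy.1
      rw [(hdφ y hy0).deriv]
      apply div_nonpos_of_nonpos_of_nonneg _ (by positivity)
      have a1 := hyF y hy0 hy.2.le
      have a2 := hyg y hy0
      have a3 := hmulpow y N
      have : y * ((w * g y ^ (w - 1) * g' y - F' y) * y ^ N -
        (g y ^ w - F y) * (N * y ^ (N - 1))) ≤ 0 := by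
        have e : y * ((w * g y ^ (w - 1) * g' y - F' y) * y ^ N -
        (g y ^ w - F y) * (N * y ^ (N - 1))) =
          (y * (w * g y ^ (w - 1) * g' y) - y * F' y - N * (g y ^ w - F y)) * y ^ N := by
          linear_combination (-(g y ^ w - F y)) * a3
        rw [e]
        apply mul_nonpos_of_nonpos_of_nonneg _ (by positivity)
        linarith
      exact nonpos_of_mul_nonpos_right this hy0
  have h1 := hanti (Set.left_mem_Icc.2 hc1) (Set.right_mem_Icc.2 hc1) hc1
  have hφ1 : 0 ≤ φ 1 := by
    have h2 : F 1 ≤ (n : ℝ) ^ w := by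
      simp only [hF, one_pow, sum_const, nsmul_eq_mul, mul_one]
      have h3 : K.index ≤ n ^ w := by
        rw [← hK]
        apply le_pow_length AddSubgroup.index_ne_zero_of_finite
        intro p hpp hpd
        exact hp p hpp (hpd.trans K.index_dvd_card)
      exact_mod_cast (card_ann_le K).trans h3
    have h4 : g 1 = n := by simp [hg]
    simp only [hφ, h4, one_pow, div_one]
    linarith
  have h5 : 0 ≤ φ c := hφ1.trans h1
  simp only [hφ] at h5
  have h6 : 0 ≤ g c ^ w - F c := by
    by_contra hcon
    push Not at hcon
    exact absurd h5 (not_le.2 (div_neg_of_neg_of_pos hcon (by positivity)))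
  linarith

lemma addChar_map_sum {H ι : Type} [AddCommGroup H] (χ : AddChar H ℂ) (I : Finset ι) (a : ι → H) :
    χ (∑ i ∈ I, a i) = ∏ i ∈ I, χ (a i) := by
  classical
  induction I using Finset.induction_on with
  | empty => simp
  | insert i I hi ih => rw [Finset.sum_insert hi, Finset.prod_insert hi, AddChar.map_add_eq_mul, ih]

open Finset in
lemma exists_subset_sum {H ι : Type} [AddCommGroup H] [Finite H] [Fintype ι] [DecidableEq ι]
    (a : ι → H) (c : ℝ)
    (hF : ∑ χ ∈ ann (⊥ : AddSubgroup H), c ^ suppCard a χ < 2)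
    (hc : ∀ χ : AddChar H ℂ, ∀ i, χ (a i) ≠ 1 → ‖1 + χ (a i)‖ ≤ 2 * c) (g : H) :
    ∃ I : Finset ι, ∑ i ∈ I, a i = g := by
  classical
  have : Fintype H := Fintype.ofFinite _
  by_contra! hcon
  have hbot : ann (⊥ : AddSubgroup H) = univ := by
    ext χ; simp [mem_ann]
  rw [hbot] at hF
  have h0 : ∑ χ : AddChar H ℂ, χ (-g) * ∏ i, (1 + χ (a i)) = 0 := by
    have : ∀ χ : AddChar H ℂ, χ (-g) * ∏ i, (1 + χ (a i)) =
        ∑ I ∈ (univ : Finset ι).powerset, χ (∑ i ∈ I, a i - g) := by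
      intro χ
      rw [prod_one_add, mul_sum]
      apply sum_congr rfl
      intro I _
      rw [sub_eq_neg_add, AddChar.map_add_eq_mul, addChar_map_sum]
    simp_rw [this]
    rw [sum_comm]
    apply sum_eq_zero
    intro I _
    rw [AddChar.sum_apply_eq_zero_iff_ne_zero, sub_ne_zero]
    exact hcon I
  rw [← add_sum_erase _ _ (mem_univ (0 : AddChar H ℂ))] at h0
  rw [← add_sum_erase _ _ (mem_univ (0 : AddChar H ℂ))] at hF
  have hs0 : suppCard a 0 = 0 := by simp [suppCard]
  rw [hs0, pow_zero] at hF
  have hb : ∀ χ : AddChar H ℂ, ‖χ (-g) * ∏ i, (1 + χ (a i))‖ ≤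
      2 ^ Fintype.card ι * c ^ suppCard a χ := by
    intro χ
    rw [norm_mul, AddChar.norm_apply, one_mul, norm_prod]
    have : ∀ i ∈ (univ : Finset ι), ‖1 + χ (a i)‖ ≤ 2 * (if χ (a i) ≠ 1 then c else 1) := by
      intro i _
      split_ifs with h
      · exact hc χ i h
      · push Not at h
        rw [h]; norm_num
    refine (prod_le_prod (fun _ _ => norm_nonneg _) this).trans ?_
    rw [prod_mul_distrib, prod_const, prod_ite, prod_const, prod_const_one, mul_one, card_univ,
      suppCard]
  have h1 : (2 : ℝ) ^ Fintype.card ι ≤ 2 ^ Fintype.card ι *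
      ∑ χ ∈ univ.erase (0 : AddChar H ℂ), c ^ suppCard a χ := by
    have h2 : ‖(2 : ℂ) ^ Fintype.card ι‖ = 2 ^ Fintype.card ι := by simp
    rw [← h2]
    have h3 : (2 : ℂ) ^ Fintype.card ι =
        - ∑ χ ∈ univ.erase (0 : AddChar H ℂ), χ (-g) * ∏ i, (1 + χ (a i)) := by
      rw [eq_neg_iff_add_eq_zero, ← h0]
      congr 1
      simp [show (1 + 1 : ℂ) = 2 by norm_num]
    nth_rewrite 1 [h3]
    rw [norm_neg, h2, mul_sum]
    exact (norm_sum_le _ _).trans (sum_le_sum fun χ _ => hb χ)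
  have h4 : (0 : ℝ) < 2 ^ Fintype.card ι := by positivity
  nlinarith

lemma le_of_sq_le_sq_aux {x y : ℝ} (hy : 0 ≤ y) (h : x ^ 2 ≤ y ^ 2) : x ≤ y :=
  (abs_le_of_sq_le_sq' h hy).2

lemma norm_one_add_le {ζ : ℂ} {n : ℕ} (hn : 0 < n) (h : ζ ^ n = 1) (h1 : ζ ≠ 1) :
    ‖1 + ζ‖ ≤ 2 * Real.exp (-(1 / (4 * (n : ℝ) ^ 2))) := by
  have hn0 : (0 : ℝ) < n := by exact_mod_cast hn
  have hnorm : ‖ζ‖ = 1 := Complex.norm_eq_one_of_pow_eq_one h hn.ne'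
  set θ := ζ.arg with hθ
  have hζ : ζ = Complex.exp (θ * Complex.I) := by
    have := Complex.norm_mul_exp_arg_mul_I ζ
    rw [hnorm] at this
    simpa using this.symm
  have hθπ : |θ| ≤ Real.pi := Complex.abs_arg_le_pi ζ
  have hθ0 : θ ≠ 0 := by
    intro h0
    apply h1
    rw [hζ, h0]; simp
  have hlow : 2 * Real.pi ≤ n * |θ| := by
    rw [hζ, ← Complex.exp_nat_mul, Complex.exp_eq_one_iff] at h
    obtain ⟨j, hj⟩ := h
    have hj' : (n : ℝ) * θ = j * (2 * Real.pi) := by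
      have h3 : ((n : ℂ) * θ) * Complex.I = (j * (2 * Real.pi)) * Complex.I := by
        linear_combination hj
      have := mul_right_cancel₀ Complex.I_ne_zero h3
      exact_mod_cast this
    have hj0 : j ≠ 0 := by
      rintro rfl
      simp at hj'
      rcases hj' with h | h
      · omega
      · exact hθ0 h
    have hj1 : (1 : ℝ) ≤ |(j : ℝ)| := by
      exact_mod_cast Int.one_le_abs hj0
    have : n * |θ| = |(j : ℝ)| * (2 * Real.pi) := by
      rw [← abs_of_pos hn0, ← abs_mul, hj', abs_mul, abs_of_pos Real.two_pi_pos]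
    rw [this]
    nlinarith [Real.pi_pos]
  have hcos := Real.cos_le_one_sub_mul_cos_sq hθπ
  have hsq : 4 * Real.pi ^ 2 ≤ (n : ℝ) ^ 2 * θ ^ 2 := by
    have := mul_self_le_mul_self (by positivity) hlow
    rw [← sq_abs θ]; nlinarith
  have hcos2 : Real.cos θ ≤ 1 - 8 / (n : ℝ) ^ 2 := by
    have : 8 / (n : ℝ) ^ 2 ≤ 2 / Real.pi ^ 2 * θ ^ 2 := by
      have hpi := Real.pi_pos
      rw [div_mul_eq_mul_div, div_le_div_iff₀ (by positivity) (by positivity)]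
      nlinarith
    linarith
  have hns : ‖1 + ζ‖ ^ 2 = 2 + 2 * Real.cos θ := by
    rw [← Complex.normSq_eq_norm_sq, Complex.normSq_apply, hζ]
    simp only [Complex.add_re, Complex.add_im, Complex.one_re, Complex.one_im,
      Complex.exp_ofReal_mul_I_re, Complex.exp_ofReal_mul_I_im]
    nlinarith [Real.sin_sq_add_cos_sq θ]
  have hexp := Real.add_one_le_exp (-(1 / (2 * (n : ℝ) ^ 2)))
  have he2 : Real.exp (-(1 / (4 * (n : ℝ) ^ 2))) ^ 2 = Real.exp (-(1 / (2 * (n : ℝ) ^ 2))) := by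
    rw [← Real.exp_nat_mul]; congr 1; field_simp; norm_num
  apply le_of_sq_le_sq_aux (by positivity)
  rw [hns, mul_pow, he2]
  have h9 : 1 / (2 * (n : ℝ) ^ 2) ≤ 4 / (n : ℝ) ^ 2 := by
    rw [div_le_div_iff₀ (by positivity) (by positivity)]
    nlinarith [sq_nonneg (n : ℝ)]
  have : 8 / (n : ℝ) ^ 2 = 2 * (4 / (n : ℝ) ^ 2) := by ring
  linarith

open Finset in
lemma group_main {G ι : Type} [AddCommGroup G] [Finite G] [Fintype ι] [DecidableEq ι]
    (a : ι → G) (m n : ℕ) (hn : 1 ≤ n) (hexp : ∀ x : G, n • x = 0)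
    (hp : ∀ p, p.Prime → p ∣ Nat.card G → p ≤ n)
    (hm : m * (Nat.card G).primeFactorsList.length < Fintype.card ι)
    (hlt : (1 + ((n : ℝ) - 1) * Real.exp (-(1 / (4 * (n : ℝ) ^ 2))) ^ m) ^
      (Nat.card G).primeFactorsList.length < 2) :
    ∃ (H : AddSubgroup G) (i₀ : ι), a i₀ ∈ H ∧
      ∀ g ∈ H, ∃ I : Finset ι, I.Nonempty ∧ ∑ i ∈ I, a i = g := by
  classical
  let P : AddSubgroup G → Prop := fun H =>
    (univ.filter (fun i => a i ∉ H)).card ≤ m * H.index.primeFactorsList.length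
  have hPtop : P ⊤ := by simp [P]
  obtain ⟨H, hPH, hmin⟩ : ∃ H, P H ∧ ∀ K, K < H → ¬ P K := by
    have hwf : WellFounded (fun K L : AddSubgroup G => K < L) := wellFounded_lt
    obtain ⟨H, h1, h2⟩ := hwf.has_min {H | P H} ⟨⊤, hPtop⟩
    exact ⟨H, h1, fun K hK hPK => h2 K hPK hK⟩
  have hcardH : Nat.card H ≠ 0 := Nat.card_pos.ne'
  have hidx : H.index ≠ 0 := AddSubgroup.index_ne_zero_of_finite
  have hlen : (Nat.card G).primeFactorsList.length =
      (Nat.card H).primeFactorsList.length + H.index.primeFactorsList.length := by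
    rw [← length_mul hcardH hidx, AddSubgroup.card_mul_index]
  have hex : ∃ i₀, a i₀ ∈ H := by
    by_contra! hcon
    have : (univ.filter (fun i => a i ∉ H)).card = Fintype.card ι := by
      rw [filter_true_of_mem (fun i _ => hcon i), card_univ]
    have h2 : P H := hPH
    simp only [P, this] at h2
    have : m * H.index.primeFactorsList.length ≤ m * (Nat.card G).primeFactorsList.length :=
      Nat.mul_le_mul_left _ (by omega)
    omega
  obtain ⟨i₀, hi₀⟩ := hex
  refine ⟨H, i₀, hi₀, ?_⟩
  let J := {i : ι // a i ∈ H ∧ i ≠ i₀}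
  let b : J → H := fun i => ⟨a i.1, i.2.1⟩
  set c := Real.exp (-(1 / (4 * (n : ℝ) ^ 2))) with hc
  have hc0 : 0 < c := Real.exp_pos _
  have hc1 : c ≤ 1 := by
    rw [hc, Real.exp_le_one_iff, neg_nonpos]; positivity
  have hcond : ∀ K : AddSubgroup H, ∀ [DecidablePred (fun i => b i ∉ K)],
      m * K.index.primeFactorsList.length ≤ (univ.filter (fun i => b i ∉ K)).card := by
    intro K' _
    by_cases hK' : K' = ⊤
    · subst hK'; simp
    set K := K'.map H.subtype with hKdef
    have hKH : K ≤ H := by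
      rintro _ ⟨x, _, rfl⟩; exact x.2
    have hmem : ∀ x : H, (x : G) ∈ K ↔ x ∈ K' := by
      intro x
      constructor
      · rintro ⟨y, hy, hyx⟩
        have : y = x := Subtype.ext hyx
        rwa [← this]
      · intro hx; exact ⟨x, hx, rfl⟩
    have hne : K ≠ H := by
      intro h
      apply hK'
      rw [AddSubgroup.eq_top_iff']
      intro x
      rw [← hmem, h]; exact x.2
    have hnP := hmin K (lt_of_le_of_ne hKH hne)
    simp only [P, not_le] at hnP
    have hPH' : (univ.filter (fun i => a i ∉ H)).card ≤ m * H.index.primeFactorsList.length := hPH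
    have hrel : K.relIndex H = K'.index := by
      have : K.addSubgroupOf H = K' := by
        ext x
        rw [AddSubgroup.mem_addSubgroupOf]; exact hmem x
      rw [AddSubgroup.relIndex, this]
    have hidx' : K'.index ≠ 0 := AddSubgroup.index_ne_zero_of_finite
    have hl : K.index.primeFactorsList.length =
        K'.index.primeFactorsList.length + H.index.primeFactorsList.length := by
      rw [← length_mul hidx' hidx, ← hrel, AddSubgroup.relIndex_mul_index hKH]
    have hsub : univ.filter (fun i => a i ∉ K) ⊆ univ.filter (fun i => a i ∉ H) ∪
        insert i₀ ((univ.filter (fun i => b i ∉ K')).image Subtype.val) := by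
      intro i hi
      have hi' : a i ∉ K := by simpa using hi
      rw [mem_union]
      by_cases h1 : a i ∈ H
      · right
        rw [mem_insert]
        by_cases h2 : i = i₀
        · left; exact h2
        · right
          rw [mem_image]
          refine ⟨⟨i, h1, h2⟩, ?_, rfl⟩
          simp only [mem_filter, mem_univ, true_and]
          rw [← hmem]
          exact hi'
      · left; simpa using h1
    have hcard := (card_le_card hsub).trans (card_union_le _ _)
    have h3 := card_insert_le i₀ ((univ.filter (fun i => b i ∉ K')).image Subtype.val)
    have h4 : ((univ.filter (fun i => b i ∉ K')).image Subtype.val).card ≤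
      (univ.filter (fun i => b i ∉ K')).card := card_image_le
    rw [hl, mul_add] at hnP
    omega
  have hbound := core_bound b m n hn
    (fun p hpp hd => hp p hpp (hd.trans (AddSubgroup.card_addSubgroup_dvd_card H))) hcond
    _ ⊥ rfl c hc0 hc1
  rw [AddSubgroup.index_bot] at hbound
  have hge : 1 ≤ 1 + ((n : ℝ) - 1) * c ^ m := by
    have : (1 : ℝ) ≤ n := by exact_mod_cast hn
    have : 0 ≤ ((n : ℝ) - 1) * c ^ m := mul_nonneg (by linarith) (by positivity)
    linarith
  have hF := (hbound.trans (pow_le_pow_right₀ hge (by omega :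
    (Nat.card H).primeFactorsList.length ≤ (Nat.card G).primeFactorsList.length))).trans_lt hlt
  intro g hg
  obtain ⟨I, hI⟩ := exists_subset_sum b c hF (by
    intro χ i hi
    apply norm_one_add_le hn _ hi
    rw [← AddChar.map_nsmul_eq_pow]
    have : n • b i = 0 := by
      apply Subtype.ext
      exact hexp _
    rw [this, AddChar.map_zero_eq_one]) (⟨g, hg⟩ - ⟨a i₀, hi₀⟩)
  refine ⟨insert i₀ (I.image Subtype.val), insert_nonempty _ _, ?_⟩
  rw [sum_insert, sum_image]
  · have := congrArg (H.subtype) hI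
    rw [map_sum] at this
    simp only [b, AddSubgroup.subtype_apply, AddSubgroup.coe_sub] at this
    rw [this]
    abel
  · intro x _ y _ h
    exact Subtype.ext h
  · simp only [mem_image, not_exists, not_and]
    intro x _ h
    exact x.2.2 h

lemma numeric {n w N : ℕ} (hn : 2 ≤ n) (hw : 1 ≤ w)
    (hN : 5 * (n : ℝ) ^ 2 * w * Real.log (3 * n * w) ≤ N) :
    ∃ m : ℕ, m * w < N ∧
      (1 + ((n : ℝ) - 1) * Real.exp (-(1 / (4 * (n : ℝ) ^ 2))) ^ m) ^ w < 2 := by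
  have hn' : (2 : ℝ) ≤ n := by exact_mod_cast hn
  have hw' : (1 : ℝ) ≤ w := by exact_mod_cast hw
  set L : ℝ := 3 * n * w with hL
  have hL6 : (6 : ℝ) ≤ L := by rw [hL]; nlinarith
  have hlog : 1 ≤ Real.log L := by
    rw [Real.le_log_iff_exp_le (by linarith)]
    linarith [Real.exp_one_lt_d9]
  refine ⟨⌈4 * (n : ℝ) ^ 2 * Real.log L⌉₊, ?_, ?_⟩
  · have h1 := Nat.ceil_lt_add_one (a := 4 * (n : ℝ) ^ 2 * Real.log L) (by positivity)
    have h2 : (⌈4 * (n : ℝ) ^ 2 * Real.log L⌉₊ : ℝ) < 5 * (n : ℝ) ^ 2 * Real.log L := by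
      have : 1 ≤ (n : ℝ) ^ 2 * Real.log L := by nlinarith
      linarith
    have h3 : (⌈4 * (n : ℝ) ^ 2 * Real.log L⌉₊ : ℝ) * w < N := by nlinarith
    exact_mod_cast h3
  · set m := ⌈4 * (n : ℝ) ^ 2 * Real.log L⌉₊ with hm
    have hm1 : 4 * (n : ℝ) ^ 2 * Real.log L ≤ m := Nat.le_ceil _
    have hc : Real.exp (-(1 / (4 * (n : ℝ) ^ 2))) ^ m ≤ 1 / L := by
      rw [← Real.exp_nat_mul, one_div L, ← Real.exp_log (show 0 < L by linarith), ← Real.exp_neg,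
        Real.exp_le_exp]
      have : Real.log L ≤ m / (4 * (n : ℝ) ^ 2) := by
        rw [le_div_iff₀ (by positivity)]; linarith
      have e : (m : ℝ) * -(1 / (4 * (n : ℝ) ^ 2)) = -(m / (4 * (n : ℝ) ^ 2)) := by ring
      rw [e]; linarith
    have h1 : 1 + ((n : ℝ) - 1) * Real.exp (-(1 / (4 * (n : ℝ) ^ 2))) ^ m ≤
        Real.exp (1 / (3 * w)) := by
      have h2 : ((n : ℝ) - 1) * Real.exp (-(1 / (4 * (n : ℝ) ^ 2))) ^ m ≤ n * (1 / L) := by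
        apply mul_le_mul (by linarith) hc (by positivity) (by linarith)
      have h3 : n * (1 / L) = 1 / (3 * w) := by rw [hL]; field_simp
      have := Real.add_one_le_exp (1 / (3 * (w : ℝ)))
      linarith
    have h0 : 0 ≤ 1 + ((n : ℝ) - 1) * Real.exp (-(1 / (4 * (n : ℝ) ^ 2))) ^ m := by
      have : 0 ≤ ((n : ℝ) - 1) * Real.exp (-(1 / (4 * (n : ℝ) ^ 2))) ^ m :=
        mul_nonneg (by linarith) (by positivity)
      linarith
    refine (pow_le_pow_left₀ h0 h1 w).trans_lt ?_
    rw [← Real.exp_nat_mul]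
    have e : (w : ℝ) * (1 / (3 * w)) = 1 / 3 := by field_simp
    rw [e, ← Real.lt_log_iff_exp_lt (by norm_num)]
    linarith [Real.log_two_gt_d9]

lemma kth_power_of_dvd {k x : ℕ} (hk : k ≠ 0) (hx : x ≠ 0)
    (h : ∀ p, p.Prime → k ∣ x.factorization p) : ∃ c, x = c ^ k := by
  refine ⟨Nat.floorRoot k x, ?_⟩
  apply Nat.eq_of_factorization_eq hx (pow_ne_zero _ (Nat.floorRoot_ne_zero.2 ⟨hk, hx⟩))
  intro p
  rw [Nat.factorization_pow, Nat.factorization_floorRoot]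
  by_cases hp : p.Prime
  · simp [Nat.mul_div_cancel' (h p hp)]
  · simp [Nat.factorization_eq_zero_of_not_prime _ hp]

theorem subset_product_kth_power (k t : ℕ) (hk : 2 ≤ k) (ht : 0 < t)
    (hkt : Nat.Coprime k t) (S : Finset ℕ) (hS : S.Nonempty)
    (hSp : ∀ p ∈ S, Nat.Prime p) (A : Finset ℕ)
    (hA : ∀ a ∈ A, ∀ p : ℕ, p.Prime → p ∣ a → p ∈ S)
    (hcard : A.card ≥ ⌈(5 * (k : ℝ) ^ 2 * (t : ℝ) ^ 2 *
        ((S.card * k.primeFactorsList.length + t.primeFactorsList.length : ℕ) : ℝ) *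
        Real.log (3 * (k : ℝ) * (t : ℝ) *
        ((S.card * k.primeFactorsList.length + t.primeFactorsList.length : ℕ) : ℝ)))⌉₊) :
    ∃ A' ⊆ A, A'.Nonempty ∧ (∃ c : ℕ, ∏ a ∈ A', a = c ^ k) ∧
      A'.card ≡ 1 [MOD t] := by
  classical
  have hA0 : ∀ a ∈ A, a ≠ 0 := by
    rintro a ha rfl
    obtain ⟨p, hp1, hp2⟩ := Nat.exists_infinite_primes (S.sup id + 1)
    have h1 := hA 0 ha p hp2 (dvd_zero p)
    have h2 : p ≤ S.sup id := Finset.le_sup (f := id) h1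
    omega
  have : NeZero k := ⟨by omega⟩
  have : NeZero t := ⟨by omega⟩
  set w := S.card * k.primeFactorsList.length + t.primeFactorsList.length with hw
  have hw1 : 1 ≤ w := by
    have h1 : 0 < k.primeFactorsList.length := by
      rw [← ArithmeticFunction.cardFactors_apply, ArithmeticFunction.cardFactors_pos_iff_one_lt]
      omega
    have h2 : 0 < S.card := hS.card_pos
    have := Nat.mul_pos h2 h1
    omega
  have hn2 : 2 ≤ k * t := by nlinarith
  obtain ⟨m, hm1, hm2⟩ := numeric (n := k * t) (w := w) (N := A.card) hn2 hw1 (by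
    have := (Nat.le_ceil _).trans (Nat.cast_le (α := ℝ).2 hcard)
    refine le_trans (le_of_eq ?_) this
    push_cast
    rw [mul_pow, show (3 : ℝ) * ((k : ℝ) * t) = 3 * k * t by ring]
    ring)
  let G := (S → ZMod k) × ZMod t
  have hGcard : Nat.card G = k ^ S.card * t := by
    simp [G, Nat.card_eq_fintype_card]
  have hGlen : (Nat.card G).primeFactorsList.length = w := by
    rw [hGcard, length_mul (pow_ne_zero _ (by omega)) (by omega), hw]
    congr 1
    exact ArithmeticFunction.cardFactors_pow
  let a : A → G := fun x => (fun p => ((x.1.factorization p.1 : ℕ) : ZMod k), 1)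
  obtain ⟨H, i₀, hi₀, hH⟩ := group_main a m (k * t) (by omega) (by
      rintro ⟨x, y⟩
      ext i
      · change (k * t) • x i = 0
        simp
      · change (k * t) • y = 0
        simp) (by
      intro p hp hd
      rw [hGcard] at hd
      apply Nat.le_of_dvd (by omega)
      rcases (hp.dvd_mul).1 hd with h | h
      · exact (hp.dvd_of_dvd_pow h).mul_right _
      · exact h.mul_left _) (by rw [hGlen]; simpa using hm1) (by rw [hGlen]; exact hm2)
  obtain ⟨u, hu⟩ : ∃ u : ℕ, ((u * k : ℕ) : ZMod t) = 1 := by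
    refine ⟨((k : ZMod t)⁻¹).val, ?_⟩
    push_cast
    rw [ZMod.natCast_zmod_val, mul_comm]
    exact ZMod.coe_mul_inv_eq_one k hkt
  have hg : ((0, 1) : G) ∈ H := by
    have := H.nsmul_mem hi₀ (u * k)
    convert this using 1
    ext i
    · change (0 : ZMod k) = (u * k) • ((a i₀).1 i)
      simp
    · change (1 : ZMod t) = (u * k) • (1 : ZMod t)
      rw [nsmul_eq_mul, mul_one]
      exact hu.symm
  obtain ⟨I, hIne, hI⟩ := hH _ hg
  have hsum1 := congrArg Prod.fst hI
  have hsum2 := congrArg Prod.snd hI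
  rw [Prod.fst_sum] at hsum1
  rw [Prod.snd_sum] at hsum2
  refine ⟨I.map (Function.Embedding.subtype _), ?_, by simpa using hIne, ?_, ?_⟩
  · intro x hx
    simp at hx
    exact hx.1
  · rw [Finset.prod_map]
    simp only [Function.Embedding.coe_subtype]
    apply kth_power_of_dvd (by omega)
    · exact Finset.prod_ne_zero_iff.2 fun x _ => hA0 _ x.2
    · intro p hp
      rw [Nat.factorization_prod (fun x _ => hA0 _ x.2), Finsupp.finsetSum_apply]
      by_cases hpS : p ∈ S
      · have := congrFun hsum1 ⟨p, hpS⟩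
        rw [Finset.sum_apply] at this
        simp only [a, Pi.zero_apply] at this
        rw [← ZMod.natCast_eq_zero_iff]
        push_cast
        exact this
      · rw [Finset.sum_eq_zero]
        · exact dvd_zero _
        · intro x _
          apply Nat.factorization_eq_zero_of_not_dvd
          intro h
          exact hpS (hA _ x.2 p hp h)
  · rw [Finset.card_map, ← ZMod.natCast_eq_natCast_iff]
    simpa [a] using hsum2
end
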